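/- arXiv:2003.09397 — 5 statements merged into one kernel-verified Lean document; each statement's English description precedes it below -/
import Mathlib

section
/- There exists p_{**} ∈ (p_*, √(2/3)) such that: for every p₀ ∈ (p_*, p_{**}) the function q₀ ↦ T₊(p₀, q₀) has exactly one critical point (i.e. exactly one q₀ with ∂T₊/∂q₀(p₀,q₀) = 0) in the interval (0, √A(p₀)); and for every p₀ ∈ [p_{**}, 1) the function q₀ ↦ T₊(p₀, q₀) has no critical points in (0, √A(p₀)). -/
open Real MeasureTheory Set Filter Topology

/-- The potential `A(u) = u²(1 − u²)`. -/
noncomputable def A (u : ℝ) : ℝ := u ^ 2 * (1 - u ^ 2)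

/-- `p⋆ = 1/√2`, the unique positive critical point of `A`, with `A p⋆ = 1/4`. -/
noncomputable def pstar : ℝ := 1 / Real.sqrt 2

/-- For energy `E > −1/4`, the unique root `p₊ > p⋆` of `A(p₊) = −E` (explicit formula). -/
noncomputable def pPlus (E : ℝ) : ℝ := Real.sqrt ((1 + Real.sqrt (1 + 4 * E)) / 2)

/-- For energy `E ∈ (−1/4, 0)`, the unique root `p₋ ∈ (0, p⋆)` of `A(p₋) = −E` (explicit formula). -/
noncomputable def pMinus (E : ℝ) : ℝ := Real.sqrt ((1 - Real.sqrt (1 + 4 * E)) / 2)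

/-- The period function `T₊(p₀,q₀) = ∫_{p₀}^{p₊} du/√(E + A(u))`, `E = q₀² − A(p₀)`. -/
noncomputable def Tplus (p₀ q₀ : ℝ) : ℝ :=
  ∫ u in p₀..pPlus (q₀ ^ 2 - A p₀), 1 / Real.sqrt ((q₀ ^ 2 - A p₀) + A u)

/-- The period function `T₋(p₀,q₀) = ∫_{p₋}^{p₀} du/√(E + A(u))`, `E = q₀² − A(p₀)`. -/
noncomputable def Tminus (p₀ q₀ : ℝ) : ℝ :=
  ∫ u in pMinus (q₀ ^ 2 - A p₀)..p₀, 1 / Real.sqrt ((q₀ ^ 2 - A p₀) + A u)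

/-- Leibniz rule for an integral whose integrand and upper endpoint both depend on a parameter. -/
theorem hasDerivAt_parametric_primitive {F F' : ℝ → ℝ → ℝ} {c a : ℝ → ℝ} {c' a' x : ℝ}
    (hF : Continuous (Function.uncurry F)) (hF' : Continuous (Function.uncurry F'))
    (hd : ∀ᶠ y in 𝓝 (c x), ∀ t, HasDerivAt (fun z => F z t) (F' y t) y)
    (hc : HasDerivAt c c' x) (ha : HasDerivAt a a' x) :
    HasDerivAt (fun y => ∫ t in (0 : ℝ)..a y, F (c y) t)
      (c' * (∫ t in (0 : ℝ)..a x, F' (c x) t) + a' * F (c x) (a x)) x := by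
  have hslice (y : ℝ) : Continuous (F y) := hF.comp (by fun_prop : Continuous fun t => (y, t))
  have hslice' (y : ℝ) : Continuous (F' y) := hF'.comp (by fun_prop : Continuous fun t => (y, t))
  have hpar (y b : ℝ) (hy : ∀ᶠ z in 𝓝 y, ∀ t, HasDerivAt (fun w => F w t) (F' z t) z) :
      HasDerivAt (fun z => ∫ t in (0 : ℝ)..b, F z t) (∫ t in (0 : ℝ)..b, F' y t) y := by
    obtain ⟨ε, hε, hball⟩ := Metric.eventually_nhds_iff_ball.1 hy
    obtain ⟨C, hC⟩ := ((isCompact_closedBall y ε).prod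
      (isCompact_uIcc (a := (0 : ℝ)) (b := b))).exists_bound_of_continuousOn hF'.continuousOn
    refine (intervalIntegral.hasDerivAt_integral_of_dominated_loc_of_deriv_le
      (bound := fun _ => C) (Metric.ball_mem_nhds y hε)
      (Eventually.of_forall fun z => (hslice z).aestronglyMeasurable)
      ((hslice y).intervalIntegrable _ _) (hslice' y).aestronglyMeasurable
      (Eventually.of_forall fun t ht z hz => ?_) intervalIntegrable_const
      (Eventually.of_forall fun t _ z hz => hball z hz t)).2
    exact hC (z, t) ⟨Metric.ball_subset_closedBall hz, uIoc_subset_uIcc ht⟩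
  have key := hasStrictFDerivAt_uncurry_coprod (𝕜 := ℝ) (u := (c x, a x))
    (f := fun y b => ∫ t in (0 : ℝ)..b, F y t)
    (f₁ := fun y b => ContinuousLinearMap.toSpanSingleton ℝ (∫ t in (0 : ℝ)..b, F' y t))
    (f₂ := fun y b => ContinuousLinearMap.toSpanSingleton ℝ (F y b))
    (by
      filter_upwards [continuous_fst.continuousAt.eventually hd.eventually_nhds] with v hv
      exact (hpar v.1 v.2 hv).hasFDerivAt)
    (Eventually.of_forall fun v =>
      (intervalIntegral.integral_hasDerivAt_right ((hslice v.1).intervalIntegrable _ _)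
        ((hslice v.1).stronglyMeasurableAtFilter _ _) (hslice v.1).continuousAt).hasFDerivAt)
    (by
      have h : Continuous fun p : ℝ × ℝ => ∫ t in (0 : ℝ)..p.2, F' p.1 t :=
        intervalIntegral.continuous_parametric_primitive_of_continuous hF'
      exact ((ContinuousLinearMap.toSpanSingletonCLE (𝕜 := ℝ) (E := ℝ)).continuous.comp
        h).continuousAt)
    ((ContinuousLinearMap.toSpanSingletonCLE (𝕜 := ℝ) (E := ℝ)).continuous.comp hF).continuousAt
  have := key.hasFDerivAt.comp_hasDerivAt x (hc.prodMk ha)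
  simpa [Function.HasUncurry.uncurry, ContinuousLinearMap.toSpanSingleton_apply] using! this

/-- The kernel `y / (1/2 + |y|)^(3/2)` of the derivative of the period function; the absolute value
only serves to make it globally continuous. -/
noncomputable def kernel (y : ℝ) : ℝ := y / √(1 / 2 + |y|) ^ 3

theorem continuous_kernel : Continuous kernel := by
  unfold kernel
  refine continuous_id.div (by fun_prop) fun y => ?_
  positivity

theorem kernel_nonneg {y : ℝ} (hy : 0 ≤ y) : 0 ≤ kernel y := by
  unfold kernel; positivity

theorem kernel_le_kernel {x y : ℝ} (hx : 0 ≤ x) (hxy : x ≤ y) (hy : y ≤ 1 / 2) :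
    kernel x ≤ kernel y := by
  have hy0 := hx.trans hxy
  unfold kernel
  rw [abs_of_nonneg hx, abs_of_nonneg hy0]
  have ha2 : √(1 / 2 + x) ^ 2 = 1 / 2 + x := Real.sq_sqrt (by linarith)
  have hb2 : √(1 / 2 + y) ^ 2 = 1 / 2 + y := Real.sq_sqrt (by linarith)
  have ha : 0 < √(1 / 2 + x) := Real.sqrt_pos.2 (by linarith)
  have hb1 : √(1 / 2 + y) ≤ 1 := Real.sqrt_le_one.2 (by linarith)
  have hab : √(1 / 2 + x) ≤ √(1 / 2 + y) := Real.sqrt_le_sqrt (by linarith)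
  set a := √(1 / 2 + x)
  set b := √(1 / 2 + y)
  have hb : 0 < b := ha.trans_le hab
  clear_value a b
  rw [div_le_div_iff₀ (by positivity) (by positivity)]
  obtain rfl : x = a ^ 2 - 1 / 2 := by linarith
  obtain rfl : y = b ^ 2 - 1 / 2 := by linarith
  have h1 : a * b ≤ 1 := by nlinarith
  have h2 : (a * b) * (a * b) ≤ 1 * (a * b) := by gcongr
  have h3 : 0 ≤ (b - a) * (1 / 2 * (a ^ 2 + a * b + b ^ 2) - a ^ 2 * b ^ 2) := by
    apply mul_nonneg (by linarith)
    nlinarith [sq_nonneg (a - b), mul_pos ha hb]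
  nlinarith

theorem le_kernel {y : ℝ} (h0 : 0 ≤ y) (hy : y ≤ 1 / 2) : y ≤ kernel y := by
  unfold kernel
  rw [abs_of_nonneg h0, le_div_iff₀ (by positivity)]
  exact mul_le_of_le_one_right h0
    (pow_le_one₀ (Real.sqrt_nonneg _) (Real.sqrt_le_one.2 (by linarith)))

theorem kernel_half : kernel (1 / 2) = 1 / 2 := by
  norm_num [kernel, abs_of_pos]

/-- The integral of the kernel along `c cos t`, which enters the derivative of the period function with
`c = √(q² + s²)` and `a = arctan (q / s)`. -/
noncomputable def kernelIntegral (c a : ℝ) : ℝ := ∫ t in (0 : ℝ)..a, kernel (c * cos t)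

theorem continuous_kernel_cos (c : ℝ) : Continuous fun t => kernel (c * cos t) :=
  continuous_kernel.comp (by fun_prop)

theorem continuous_kernelIntegral : Continuous fun p : ℝ × ℝ => kernelIntegral p.1 p.2 :=
  intervalIntegral.continuous_parametric_primitive_of_continuous
    (f := fun c t : ℝ => kernel (c * cos t)) (continuous_kernel.comp (by fun_prop))

theorem kernelIntegral_mono {c c' a a' : ℝ} (hc : 0 ≤ c) (hcc : c ≤ c') (hc' : c' ≤ 1 / 2)
    (ha : 0 ≤ a) (haa : a ≤ a') (ha' : a' ≤ π / 2) :
    kernelIntegral c a ≤ kernelIntegral c' a' := by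
  have hcos : ∀ t ∈ Icc 0 a', 0 ≤ cos t := fun t ht =>
    cos_nonneg_of_mem_Icc ⟨by linarith [ht.1, Real.pi_pos], ht.2.trans ha'⟩
  calc kernelIntegral c a ≤ kernelIntegral c' a := by
        refine intervalIntegral.integral_mono_on ha
          ((continuous_kernel_cos c).intervalIntegrable _ _)
          ((continuous_kernel_cos c').intervalIntegrable _ _) fun t ht => ?_
        have h := hcos t ⟨ht.1, ht.2.trans haa⟩
        exact kernel_le_kernel (by positivity) (by gcongr) (by nlinarith [cos_le_one t])
    _ ≤ kernelIntegral c' a' := by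
        refine intervalIntegral.integral_mono_interval le_rfl ha haa ?_
          ((continuous_kernel_cos c').intervalIntegrable _ _)
        filter_upwards [ae_restrict_mem measurableSet_Ioc] with t ht
        exact kernel_nonneg (mul_nonneg (hc.trans hcc) (hcos t ⟨ht.1.le, ht.2⟩))

theorem kernelIntegral_le {c a : ℝ} (hc : 0 ≤ c) (hc' : c ≤ 1 / 2) (ha : 0 ≤ a) (ha' : a ≤ π / 2) :
    kernelIntegral c a ≤ π / 4 := by
  calc kernelIntegral c a ≤ ∫ _ in (0 : ℝ)..a, (1 / 2 : ℝ) := by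
        refine intervalIntegral.integral_mono_on ha
          ((continuous_kernel_cos c).intervalIntegrable _ _) (by simp) fun t ht => ?_
        have h : 0 ≤ cos t :=
          cos_nonneg_of_mem_Icc ⟨by linarith [ht.1, Real.pi_pos], ht.2.trans ha'⟩
        rw [← kernel_half]
        exact kernel_le_kernel (by positivity) (by nlinarith [cos_le_one t]) le_rfl
    _ ≤ π / 4 := by
        rw [intervalIntegral.integral_const, smul_eq_mul]; linarith

theorem le_kernelIntegral {c a : ℝ} (hc : 0 ≤ c) (hc' : c ≤ 1 / 2) (ha : 0 ≤ a)
    (ha' : a ≤ π / 2) : c * sin a ≤ kernelIntegral c a := by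
  calc c * sin a = ∫ t in (0 : ℝ)..a, c * cos t := by simp
    _ ≤ kernelIntegral c a := by
        refine intervalIntegral.integral_mono_on ha
          (Continuous.intervalIntegrable (by fun_prop) _ _)
          ((continuous_kernel_cos c).intervalIntegrable _ _) fun t ht => ?_
        have h : 0 ≤ cos t :=
          cos_nonneg_of_mem_Icc ⟨by linarith [ht.1, Real.pi_pos], ht.2.trans ha'⟩
        exact le_kernel (by positivity) (by nlinarith [cos_le_one t])

/-- With `s = p₀² - 1/2` and `c² = q² + s²`, the derivative `∂T₊/∂q₀` equals
`q / (2 c²) * periodSlope s q`. -/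
noncomputable def periodSlope (s q : ℝ) : ℝ :=
  s / (q * √(1 / 2 + s)) - 1 / 2 * kernelIntegral √(q ^ 2 + s ^ 2) (arctan (q / s))

theorem A_sqrt {s : ℝ} (hs : 0 ≤ s) : A √(1 / 2 + s) = 1 / 4 - s ^ 2 := by
  unfold A
  rw [Real.sq_sqrt (by linarith)]; ring

theorem sqrt_mul_cos_arctan {s q : ℝ} (hs : 0 < s) :
    √(q ^ 2 + s ^ 2) * cos (arctan (q / s)) = s := by
  rw [cos_arctan]
  have : √(q ^ 2 + s ^ 2) = s * √(1 + (q / s) ^ 2) := by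
    rw [← Real.sqrt_sq hs.le, ← Real.sqrt_mul (by positivity), Real.sqrt_sq hs.le]
    congr 1
    field_simp
    ring
  rw [this]
  have : 0 < √(1 + (q / s) ^ 2) := by positivity
  field_simp

theorem half_add_mul_cos_pos {c : ℝ} (hc : 0 ≤ c) (hc' : c < 1 / 2) (t : ℝ) :
    0 < 1 / 2 + c * cos t := by
  nlinarith [neg_one_le_cos t]

theorem Tplus_eq {s q : ℝ} (hs : 0 < s) (hq : 0 < q) (hc : √(q ^ 2 + s ^ 2) < 1 / 2) :
    Tplus √(1 / 2 + s) q =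
      1 / 2 * ∫ t in (0 : ℝ)..arctan (q / s), 1 / √(1 / 2 + √(q ^ 2 + s ^ 2) * cos t) := by
  have hend : √(q ^ 2 + s ^ 2) * cos (arctan (q / s)) = s := sqrt_mul_cos_arctan hs
  have hc0 : 0 < √(q ^ 2 + s ^ 2) := by positivity
  have hc2 : √(q ^ 2 + s ^ 2) ^ 2 = q ^ 2 + s ^ 2 := Real.sq_sqrt (by positivity)
  unfold Tplus
  rw [A_sqrt hs.le]
  set c := √(q ^ 2 + s ^ 2)
  have ha0 : 0 < arctan (q / s) := arctan_pos.2 (by positivity)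
  have ha1 : arctan (q / s) < π / 2 := arctan_lt_pi_div_two _
  set a := arctan (q / s)
  have hE : q ^ 2 - (1 / 4 - s ^ 2) = c ^ 2 - 1 / 4 := by rw [hc2]; ring
  have hpP : pPlus (c ^ 2 - 1 / 4) = √(1 / 2 + c * cos 0) := by
    unfold pPlus
    rw [show 1 + 4 * (c ^ 2 - 1 / 4) = (2 * c) ^ 2 by ring, Real.sqrt_sq (by positivity), cos_zero]
    congr 1; ring
  have hpos := half_add_mul_cos_pos hc0.le hc
  have hsin : ∀ t ∈ Ioc 0 a, 0 < sin t := fun t ht =>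
    sin_pos_of_pos_of_lt_pi ht.1 (by linarith [ht.2, Real.pi_pos])
  rw [hE, hpP]
  have hsub := intervalIntegral.integral_deriv_smul_comp_of_deriv_nonpos (a := 0) (b := a)
    (f := fun t => √(1 / 2 + c * cos t)) (f' := fun t => -(c * sin t) / (2 * √(1 / 2 + c * cos t)))
    (g := fun u => 1 / √(c ^ 2 - 1 / 4 + A u)) (by fun_prop)
    (fun t _ => by
      have h := (((hasDerivAt_cos t).const_mul c).const_add (1 / 2)).sqrt (hpos t).ne'
      convert h using 1
      ring)
    (fun t ht => by
      rw [min_eq_left ha0.le, max_eq_right ha0.le] at ht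
      have := hsin t ⟨ht.1, ht.2.le⟩
      have := mul_pos hc0 this
      exact div_nonpos_of_nonpos_of_nonneg (by linarith) (by positivity))
  simp only [hend] at hsub
  rw [intervalIntegral.integral_symm, ← hsub, ← intervalIntegral.integral_neg,
    ← intervalIntegral.integral_const_mul]
  refine intervalIntegral.integral_congr_ae (Eventually.of_forall fun t ht => ?_)
  rw [uIoc_of_le ha0.le] at ht
  have hst := hsin t ht
  have hA : c ^ 2 - 1 / 4 + A √(1 / 2 + c * cos t) = (c * sin t) ^ 2 := by
    unfold A
    rw [Real.sq_sqrt (hpos t).le, mul_pow, sin_sq]; ring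
  have := Real.sqrt_pos.2 (hpos t)
  simp only [Function.comp_apply, smul_eq_mul, hA]
  rw [Real.sqrt_sq (by positivity)]
  field_simp

theorem hasDerivAt_Tplus {s q : ℝ} (hs : 0 < s) (hq : 0 < q) (hc : √(q ^ 2 + s ^ 2) < 1 / 2) :
    HasDerivAt (Tplus √(1 / 2 + s)) (q / (2 * (q ^ 2 + s ^ 2)) * periodSlope s q) q := by
  set δ := (1 / 2 - √(q ^ 2 + s ^ 2)) / 2 with hδ
  have hδ0 : 0 < δ := by rw [hδ]; linarith
  have hcder : HasDerivAt (fun y : ℝ => √(y ^ 2 + s ^ 2)) (q / √(q ^ 2 + s ^ 2)) q := by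
    have h := ((hasDerivAt_pow 2 q).add_const (s ^ 2)).sqrt (by positivity)
    convert h using 1
    norm_num
    field_simp
  have hader : HasDerivAt (fun y : ℝ => arctan (y / s)) (s / (q ^ 2 + s ^ 2)) q := by
    have h := ((hasDerivAt_id' q).div_const s).arctan
    convert h using 1
    field_simp
    ring
  have hcpos : ∀ y : ℝ, 0 < √(y ^ 2 + s ^ 2) := fun y => by positivity
  have hreg : ∀ z, |z| < 1 / 2 - δ → ∀ t, δ < 1 / 2 + z * cos t := fun z hz t => by
    have h1 : |z * cos t| ≤ |z| := by
      rw [abs_mul]; exact mul_le_of_le_one_right (abs_nonneg z) (abs_cos_le_one t)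
    linarith [neg_abs_le (z * cos t)]
  have hnear : |√(q ^ 2 + s ^ 2)| < 1 / 2 - δ := by
    rw [abs_of_pos (hcpos q)]; linarith
  have hmain := hasDerivAt_parametric_primitive (x := q)
    (F := fun z t => 1 / √(max (1 / 2 + z * cos t) δ))
    (F' := fun z t => -(1 / 2) * (cos t / √(max (1 / 2 + z * cos t) δ) ^ 3))
    (by
      unfold Function.uncurry
      refine continuous_const.div (by fun_prop) fun p => ?_
      exact (Real.sqrt_pos.2 (lt_max_of_lt_right hδ0)).ne')
    (by
      unfold Function.uncurry
      refine continuous_const.mul (Continuous.div (by fun_prop) (by fun_prop) fun p => ?_)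
      exact (pow_pos (Real.sqrt_pos.2 (lt_max_of_lt_right hδ0)) 3).ne')
    (by
      have hopen : IsOpen {z : ℝ | |z| < 1 / 2 - δ} := isOpen_lt (by fun_prop) (by fun_prop)
      filter_upwards [hopen.mem_nhds hnear] with y hy t
      have hyt := hreg y hy t
      have hpos : 0 < √(1 / 2 + y * cos t) := Real.sqrt_pos.2 (hδ0.trans hyt)
      have h := ((((hasDerivAt_id y).mul_const (cos t)).const_add (1 / 2)).sqrt
        (hδ0.trans hyt).ne').inv hpos.ne'
      rw [max_eq_left hyt.le]
      refine (h.congr_deriv ?_).congr_of_eventuallyEq ?_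
      · simp only [id]
        field_simp
      · filter_upwards [hopen.mem_nhds hy] with z hz
        rw [max_eq_left (hreg z hz t).le, one_div]
        rfl)
    hcder hader
  have hev : Tplus √(1 / 2 + s) =ᶠ[𝓝 q] fun y => 1 / 2 * ∫ t in (0 : ℝ)..arctan (y / s),
      1 / √(max (1 / 2 + √(y ^ 2 + s ^ 2) * cos t) δ) := by
    have hcont : ContinuousAt (fun y : ℝ => √(y ^ 2 + s ^ 2)) q := hcder.continuousAt
    filter_upwards [lt_mem_nhds hq, hcont.eventually_lt_const
      (show √(q ^ 2 + s ^ 2) < 1 / 2 - δ by linarith)] with y hy hyc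
    rw [Tplus_eq hs hy (by linarith)]
    congr 1
    refine intervalIntegral.integral_congr fun t _ => ?_
    rw [max_eq_left (hreg _ (by rwa [abs_of_pos (hcpos y)]) t).le]
  refine ((hmain.const_mul (1 / 2)).congr_deriv ?_).congr_of_eventuallyEq hev
  rw [max_eq_left (hreg _ hnear _).le, sqrt_mul_cos_arctan hs]
  have hint : kernelIntegral √(q ^ 2 + s ^ 2) (arctan (q / s)) = √(q ^ 2 + s ^ 2) *
      ∫ t in (0 : ℝ)..arctan (q / s), cos t / √(max (1 / 2 + √(q ^ 2 + s ^ 2) * cos t) δ) ^ 3 := by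
    rw [kernelIntegral, ← intervalIntegral.integral_const_mul]
    refine intervalIntegral.integral_congr fun t ht => ?_
    rw [uIcc_of_le (arctan_nonneg.2 (by positivity))] at ht
    have hcos : 0 ≤ cos t := cos_nonneg_of_mem_Icc
      ⟨by linarith [ht.1, Real.pi_pos], ht.2.trans (arctan_lt_pi_div_two _).le⟩
    rw [max_eq_left (hreg _ hnear t).le, kernel, abs_of_nonneg (by positivity), mul_div_assoc]
  rw [periodSlope, hint, intervalIntegral.integral_const_mul]
  have hc2 : √(q ^ 2 + s ^ 2) ^ 2 = q ^ 2 + s ^ 2 := Real.sq_sqrt (by positivity)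
  have hp : 0 < √(1 / 2 + s) := by positivity
  have hcq := hcpos q
  set c := √(q ^ 2 + s ^ 2)
  rw [← hc2]
  field_simp
  ring

theorem sqrt_sq_add_sq_le_half {s q : ℝ} (hs : 0 < s) (hs' : s < 1 / 2) (hq : 0 < q)
    (hq' : q ≤ √(1 / 4 - s ^ 2)) : √(q ^ 2 + s ^ 2) ≤ 1 / 2 := by
  have h2 : √(1 / 4 - s ^ 2) ^ 2 = 1 / 4 - s ^ 2 := Real.sq_sqrt (by nlinarith)
  apply Real.sqrt_le_iff.2 ⟨by norm_num, ?_⟩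
  nlinarith

theorem deriv_Tplus_eq_zero_iff {s q : ℝ} (hs : 0 < s) (hq : 0 < q) (hq' : q < √(1 / 4 - s ^ 2)) :
    deriv (fun y => Tplus √(1 / 2 + s) y) q = 0 ↔ periodSlope s q = 0 := by
  have hc : √(q ^ 2 + s ^ 2) < 1 / 2 := by
    rw [Real.lt_sqrt hq.le] at hq'
    rw [Real.sqrt_lt' (by norm_num)]
    linarith
  rw [(hasDerivAt_Tplus hs hq hc).deriv, mul_eq_zero, or_iff_right]
  positivity

theorem periodSlope_strictAntiOn {s : ℝ} (hs : 0 < s) (hs' : s < 1 / 2) :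
    StrictAntiOn (periodSlope s) (Ioc 0 √(1 / 4 - s ^ 2)) := by
  intro q hq q' hq' hlt
  have hp : 0 < √(1 / 2 + s) := by positivity
  have h1 : s / (q' * √(1 / 2 + s)) < s / (q * √(1 / 2 + s)) := by
    have := hq.1
    gcongr
  have h2 : kernelIntegral √(q ^ 2 + s ^ 2) (arctan (q / s)) ≤
      kernelIntegral √(q' ^ 2 + s ^ 2) (arctan (q' / s)) := by
    have := hq.1
    exact kernelIntegral_mono (by positivity) (Real.sqrt_le_sqrt (by gcongr))
      (sqrt_sq_add_sq_le_half hs hs' hq'.1 hq'.2) (arctan_nonneg.2 (by positivity))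
      (arctan_mono (by gcongr)) (arctan_lt_pi_div_two _).le
  unfold periodSlope
  linarith

theorem continuousOn_periodSlope {s : ℝ} (hs : 0 < s) :
    ContinuousOn (periodSlope s) (Ioi 0) := by
  have hp : 0 < √(1 / 2 + s) := by positivity
  have h : Continuous fun q => kernelIntegral √(q ^ 2 + s ^ 2) (arctan (q / s)) :=
    continuous_kernelIntegral.comp (f := fun q => (√(q ^ 2 + s ^ 2), arctan (q / s))) (by fun_prop)
  refine ContinuousOn.sub (ContinuousOn.div (by fun_prop) (by fun_prop) fun q hq => ?_)
    (h.continuousOn.const_smul (1 / 2 : ℝ))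
  exact (mul_pos hq hp).ne'

/-- The value of `periodSlope s` at the right endpoint `√(1/4 - s²)` of the range of `q`. -/
noncomputable def endSlope (s : ℝ) : ℝ :=
  s / (√(1 / 4 - s ^ 2) * √(1 / 2 + s)) -
    1 / 2 * kernelIntegral (1 / 2) (arctan (√(1 / 4 - s ^ 2) / s))

theorem periodSlope_endpoint {s : ℝ} (hs : 0 < s) (hs' : s < 1 / 2) :
    periodSlope s √(1 / 4 - s ^ 2) = endSlope s := by
  have h : √(√(1 / 4 - s ^ 2) ^ 2 + s ^ 2) = 1 / 2 := by
    rw [Real.sq_sqrt (by nlinarith), sub_add_cancel, show (1 / 4 : ℝ) = (1 / 2) ^ 2 by norm_num,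
      Real.sqrt_sq (by norm_num)]
  rw [periodSlope, endSlope, h]

theorem endSlope_strictMonoOn : StrictMonoOn endSlope (Ioo 0 (1 / 2)) := by
  intro s hs r hr hlt
  have hs0 := hs.1
  have hr0 := hr.1
  have hQr : 0 < √(1 / 4 - r ^ 2) := Real.sqrt_pos.2 (by nlinarith [hr.2])
  have hQ : √(1 / 4 - r ^ 2) ≤ √(1 / 4 - s ^ 2) := Real.sqrt_le_sqrt (by gcongr)
  have hcancel : ∀ x : ℝ, 0 < x → x / √(1 / 2 + x) = √(x * (x / (1 / 2 + x))) := fun x hx => by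
    rw [← mul_div_assoc, Real.sqrt_div (by positivity), ← sq, Real.sqrt_sq hx.le]
  have hnum : s / √(1 / 2 + s) < r / √(1 / 2 + r) := by
    rw [hcancel s hs0, hcancel r hr0]
    apply Real.sqrt_lt_sqrt (by positivity)
    refine mul_lt_mul'' hlt ?_ hs0.le (by positivity)
    rw [div_lt_div_iff₀ (by positivity) (by positivity)]
    nlinarith
  have h1 : s / (√(1 / 4 - s ^ 2) * √(1 / 2 + s)) < r / (√(1 / 4 - r ^ 2) * √(1 / 2 + r)) := by
    rw [mul_comm, ← div_div, mul_comm, ← div_div]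
    have : 0 ≤ s / √(1 / 2 + s) := by positivity
    gcongr
  have h2 : kernelIntegral (1 / 2) (arctan (√(1 / 4 - r ^ 2) / r)) ≤
      kernelIntegral (1 / 2) (arctan (√(1 / 4 - s ^ 2) / s)) :=
    kernelIntegral_mono (by norm_num) le_rfl le_rfl (arctan_nonneg.2 (by positivity))
      (arctan_mono (by gcongr)) (arctan_lt_pi_div_two _).le
  unfold endSlope
  linarith

theorem continuousOn_endSlope : ContinuousOn endSlope (Ioo 0 (1 / 2)) := by
  have h : ContinuousOn (fun s => kernelIntegral (1 / 2) (arctan (√(1 / 4 - s ^ 2) / s)))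
      (Ioo 0 (1 / 2)) := by
    refine continuous_kernelIntegral.comp_continuousOn
      (f := fun s : ℝ => ((1 / 2 : ℝ), arctan (√(1 / 4 - s ^ 2) / s)))
      (continuousOn_const.prodMk (continuous_arctan.comp_continuousOn ?_))
    exact ContinuousOn.div (by fun_prop) (by fun_prop) fun s hs => hs.1.ne'
  refine ContinuousOn.sub (ContinuousOn.div (by fun_prop) (by fun_prop) fun s hs => ?_)
    (h.const_mul _)
  have h1 : 0 < √(1 / 4 - s ^ 2) := Real.sqrt_pos.2 (by nlinarith [hs.1, hs.2])
  have h2 : 0 < √(1 / 2 + s) := Real.sqrt_pos.2 (by linarith [hs.1])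
  positivity

theorem endSlope_sixth_pos : 0 < endSlope (1 / 6) := by
  have h : kernelIntegral (1 / 2) (arctan (√(1 / 4 - (1 / 6) ^ 2) / (1 / 6))) ≤ π / 4 :=
    kernelIntegral_le (by norm_num) le_rfl (arctan_nonneg.2 (by positivity))
      (arctan_lt_pi_div_two _).le
  have h1 : (2 : ℝ) / 5 < 1 / 6 / (√(1 / 4 - (1 / 6) ^ 2) * √(1 / 2 + 1 / 6)) := by
    rw [← Real.sqrt_mul (by norm_num)]
    have : √((1 / 4 - (1 / 6 : ℝ) ^ 2) * (1 / 2 + 1 / 6)) < 5 / 12 := by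
      rw [Real.sqrt_lt' (by norm_num)]; norm_num
    rw [lt_div_iff₀ (Real.sqrt_pos.2 (by norm_num))]
    linarith
  unfold endSlope
  linarith [Real.pi_lt_d2]

theorem endSlope_hundredth_neg : endSlope (1 / 100) < 0 := by
  have h := le_kernelIntegral (c := 1 / 2) (a := arctan (√(1 / 4 - (1 / 100) ^ 2) / (1 / 100)))
    (by norm_num) le_rfl (arctan_nonneg.2 (by positivity)) (arctan_lt_pi_div_two _).le
  have hQ : (2 : ℝ) / 5 < √(1 / 4 - (1 / 100) ^ 2) := by
    rw [Real.lt_sqrt (by norm_num)]; norm_num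
  have hsin : (1 / 2 : ℝ) < sin (arctan (√(1 / 4 - (1 / 100) ^ 2) / (1 / 100))) := by
    rw [sin_arctan, lt_div_iff₀ (by positivity)]
    have : √(1 + (√(1 / 4 - (1 / 100 : ℝ) ^ 2) / (1 / 100)) ^ 2) <
        2 * (√(1 / 4 - (1 / 100) ^ 2) / (1 / 100)) := by
      rw [Real.sqrt_lt' (by positivity)]
      nlinarith
    linarith
  have h1 : (1 : ℝ) / 100 / (√(1 / 4 - (1 / 100) ^ 2) * √(1 / 2 + 1 / 100)) < 1 / 10 := by
    have hp : (1 : ℝ) / 2 < √(1 / 2 + 1 / 100) := by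
      rw [Real.lt_sqrt (by norm_num)]; norm_num
    rw [div_lt_iff₀ (by positivity)]
    nlinarith
  unfold endSlope
  linarith

theorem exists_endSlope_eq_zero : ∃ s ∈ Ioo (0 : ℝ) (1 / 6), endSlope s = 0 := by
  obtain ⟨s, hs, h⟩ := intermediate_value_Ioo (by norm_num : (1 / 100 : ℝ) ≤ 1 / 6)
    (continuousOn_endSlope.mono fun x hx =>
      ⟨by linarith [hx.1], by linarith [hx.2]⟩)
    (show (0 : ℝ) ∈ Ioo _ _ from ⟨endSlope_hundredth_neg, endSlope_sixth_pos⟩)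
  exact ⟨s, ⟨by linarith [hs.1], hs.2⟩, h⟩

theorem periodSlope_self_pos {s : ℝ} (hs : 0 < s) (hs' : s ≤ 1 / 6) : 0 < periodSlope s s := by
  have h : kernelIntegral √(s ^ 2 + s ^ 2) (arctan (s / s)) ≤ π / 4 :=
    kernelIntegral_le (by positivity) (Real.sqrt_le_iff.2 ⟨by norm_num, by nlinarith⟩)
      (arctan_nonneg.2 (by positivity)) (arctan_lt_pi_div_two _).le
  have h1 : 1 ≤ s / (s * √(1 / 2 + s)) := by
    rw [one_le_div (by positivity)]
    exact mul_le_of_le_one_right hs.le (Real.sqrt_le_one.2 (by linarith))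
  unfold periodSlope
  linarith [Real.pi_lt_d2]

theorem pstar_eq : pstar = √(1 / 2) := by
  rw [pstar, Real.sqrt_div zero_le_one, Real.sqrt_one]

/-- there exists `p⋆⋆ ∈ (p⋆, √(2/3))` such that for every `p₀ ∈ (p⋆, p⋆⋆)`
the map `q₀ ↦ T₊(p₀,q₀)` has exactly one critical point in `(0, √A(p₀))`, while for every
`p₀ ∈ [p⋆⋆, 1)` it has no critical point in `(0, √A(p₀))`. -/
theorem exists_pstarstar :
    ∃ pss ∈ Set.Ioo pstar (Real.sqrt (2 / 3)),
      (∀ p₀ ∈ Set.Ioo pstar pss,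
        ∃! q₀ : ℝ, q₀ ∈ Set.Ioo 0 (Real.sqrt (A p₀)) ∧
          deriv (fun q => Tplus p₀ q) q₀ = 0) ∧
      (∀ p₀ ∈ Set.Ico pss 1, ∀ q₀ ∈ Set.Ioo (0 : ℝ) (Real.sqrt (A p₀)),
        deriv (fun q => Tplus p₀ q) q₀ ≠ 0) := by
  obtain ⟨r, ⟨hr0, hr6⟩, hr⟩ := exists_endSlope_eq_zero
  have hrmem : r ∈ Ioo (0 : ℝ) (1 / 2) := ⟨hr0, by linarith⟩
  have hparam : ∀ p : ℝ, √(1 / 2) < p → ∃ s, 0 < s ∧ p = √(1 / 2 + s) := fun p hp =>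
    ⟨p ^ 2 - 1 / 2, by
      have := (Real.sqrt_lt' ((Real.sqrt_nonneg _).trans_lt hp)).1 hp
      linarith, by
      rw [add_sub_cancel, Real.sqrt_sq ((Real.sqrt_nonneg _).trans hp.le)]⟩
  rw [pstar_eq]
  refine ⟨√(1 / 2 + r), ⟨Real.sqrt_lt_sqrt (by norm_num) (by linarith),
    Real.sqrt_lt_sqrt (by positivity) (by linarith)⟩, ?_, ?_⟩
  · rintro p ⟨hp, hpr⟩
    obtain ⟨s, hs, rfl⟩ := hparam p hp
    have hsr : s < r := by
      have := (Real.sqrt_lt_sqrt_iff (by positivity)).1 hpr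
      linarith
    have hs2 : s < 1 / 2 := by linarith
    rw [A_sqrt hs.le]
    have hsQ : s ≤ √(1 / 4 - s ^ 2) := Real.le_sqrt_of_sq_le (by nlinarith)
    have hneg : periodSlope s √(1 / 4 - s ^ 2) < 0 := by
      rw [periodSlope_endpoint hs hs2, ← hr]
      exact endSlope_strictMonoOn ⟨hs, hs2⟩ hrmem hsr
    obtain ⟨q, hq, hq0⟩ := intermediate_value_Ioo' hsQ
      ((continuousOn_periodSlope hs).mono fun x hx => hs.trans_le hx.1)
      (show (0 : ℝ) ∈ Ioo _ _ from ⟨hneg, periodSlope_self_pos hs (by linarith)⟩)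
    have hqpos : 0 < q := hs.trans hq.1
    refine ⟨q, ⟨⟨hqpos, hq.2⟩, (deriv_Tplus_eq_zero_iff hs hqpos hq.2).2 hq0⟩, ?_⟩
    rintro y ⟨hy, hy0⟩
    rw [deriv_Tplus_eq_zero_iff hs hy.1 hy.2] at hy0
    exact (periodSlope_strictAntiOn hs hs2).injOn ⟨hy.1, hy.2.le⟩ ⟨hqpos, hq.2.le⟩
      (hy0.trans hq0.symm)
  · rintro p ⟨hpr, hp1⟩ q hq
    obtain ⟨s, hs, rfl⟩ := hparam p
      ((Real.sqrt_lt_sqrt (by norm_num) (by linarith)).trans_le hpr)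
    have hrs : r ≤ s := by
      have := (Real.sqrt_le_sqrt_iff (by positivity)).1 hpr
      linarith
    have hs2 : s < 1 / 2 := by
      rw [Real.sqrt_lt' one_pos] at hp1
      linarith
    rw [A_sqrt hs.le] at hq
    rw [Ne, deriv_Tplus_eq_zero_iff hs hq.1 hq.2]
    have h1 : 0 ≤ endSlope s := by
      rw [← hr]
      exact endSlope_strictMonoOn.monotoneOn hrmem ⟨hs, hs2⟩ hrs
    have h2 := periodSlope_strictAntiOn hs hs2 ⟨hq.1, hq.2.le⟩ ⟨hq.1.trans hq.2, le_rfl⟩ hq.2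
    rw [periodSlope_endpoint hs hs2] at h2
    exact (h1.trans_lt h2).ne'
end

section
/- Fix an integer N ≥ 2. There exists exactly one p₀ ∈ (p_*, p_{**}) for which q_max(p₀) = (1/(2N))√A(p₀), where q_max(p₀) denotes the unique critical point of q₀ ↦ T₊(p₀,q₀) in (0, √A(p₀)); equivalently, there is exactly one p₀ ∈ (p_*, p_{**}) such that ∂T₊/∂q₀(p₀, (1/(2N))√A(p₀)) = 0. -/
open Real MeasureTheory Set Filter Topology

/-- The function `√(1/2 + |c cos x|)`; for `c ≥ 0` and `x ∈ [0, π/2]` this is the value of `u` at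
the point with polar coordinates `(c, x)` in the plane of `(u² − 1/2, √(E + A u))`. -/
noncomputable def polarRadius (c x : ℝ) : ℝ := Real.sqrt (1 / 2 + |c * Real.cos x|)

/-- The angle with `cos = w / √(w² + q²)` and `sin = q / √(w² + q²)` for `q > 0`. -/
noncomputable def polarAngle (w q : ℝ) : ℝ := π / 2 - Real.arctan (w / q)

/-- Minus four times the `c`-derivative of `∫ x in 0..φ, 1 / (2 * polarRadius c x)`. -/
noncomputable def angularIntegral (c φ : ℝ) : ℝ :=
  ∫ x in (0 : ℝ)..φ, |Real.cos x| / polarRadius c x ^ 3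

/-- The `q`-derivative of the period function `T₊`, as a function of `w = p² − 1/2` and `q`. -/
noncomputable def periodDeriv (w q : ℝ) : ℝ :=
  w / (2 * (w ^ 2 + q ^ 2) * Real.sqrt (1 / 2 + w)) -
    q / (4 * Real.sqrt (w ^ 2 + q ^ 2)) *
      angularIntegral (Real.sqrt (w ^ 2 + q ^ 2)) (polarAngle w q)

lemma polarRadius_pos (c x : ℝ) : 0 < polarRadius c x := by
  unfold polarRadius; positivity

lemma continuous_polarRadius : Continuous fun v : ℝ × ℝ => polarRadius v.1 v.2 := by
  unfold polarRadius; fun_prop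

lemma sqrt_sq_add_sq {w q : ℝ} (hq : 0 < q) :
    Real.sqrt (w ^ 2 + q ^ 2) = q * Real.sqrt (1 + (w / q) ^ 2) := by
  rw [← Real.sqrt_sq hq.le, ← Real.sqrt_mul (sq_nonneg q), Real.sqrt_sq hq.le]
  congr 1; field_simp; ring

lemma sqrt_mul_cos_polarAngle {w q : ℝ} (hq : 0 < q) :
    Real.sqrt (w ^ 2 + q ^ 2) * Real.cos (polarAngle w q) = w := by
  have h' : 0 < Real.sqrt (1 + (w / q) ^ 2) := by positivity
  rw [polarAngle, Real.cos_pi_div_two_sub, Real.sin_arctan, sqrt_sq_add_sq hq]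
  field_simp

lemma sqrt_mul_sin_polarAngle {w q : ℝ} (hq : 0 < q) :
    Real.sqrt (w ^ 2 + q ^ 2) * Real.sin (polarAngle w q) = q := by
  have h' : 0 < Real.sqrt (1 + (w / q) ^ 2) := by positivity
  rw [polarAngle, Real.sin_pi_div_two_sub, Real.cos_arctan, sqrt_sq_add_sq hq]
  field_simp

lemma polarAngle_pos (w q : ℝ) : 0 < polarAngle w q := by
  have := Real.arctan_lt_pi_div_two (w / q)
  unfold polarAngle; linarith

lemma polarAngle_le {w q : ℝ} (hw : 0 ≤ w) (hq : 0 < q) : polarAngle w q ≤ π / 2 := by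
  have := Real.arctan_nonneg.2 (div_nonneg hw hq.le)
  unfold polarAngle; linarith

/-- The period function in polar coordinates. -/
lemma Tplus_eq_integral {p q : ℝ} (hp : 0 < p) (hw : 0 < p ^ 2 - 1 / 2) (hq : 0 < q) :
    Tplus p q = ∫ x in (0 : ℝ)..polarAngle (p ^ 2 - 1 / 2) q,
      1 / (2 * polarRadius (Real.sqrt ((p ^ 2 - 1 / 2) ^ 2 + q ^ 2)) x) := by
  set w := p ^ 2 - 1 / 2 with hwdef
  set c := Real.sqrt (w ^ 2 + q ^ 2) with hc
  set φ := polarAngle w q with hφ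
  have hc0 : 0 < c := by positivity
  have hc2 : c ^ 2 = w ^ 2 + q ^ 2 := Real.sq_sqrt (by positivity)
  have hE : q ^ 2 - A p = c ^ 2 - 1 / 4 := by rw [hc2, hwdef]; unfold A; ring
  have hcos : c * Real.cos φ = w := sqrt_mul_cos_polarAngle hq
  have hφ0 : 0 < φ := polarAngle_pos w q
  have hφ1 : φ ≤ π / 2 := polarAngle_le hw.le hq
  set f : ℝ → ℝ := fun x => Real.sqrt (1 / 2 + c * Real.cos x) with hf
  set g : ℝ → ℝ := fun u => 1 / Real.sqrt ((c ^ 2 - 1 / 4) + A u) with hg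
  have hf0 : f 0 = pPlus (c ^ 2 - 1 / 4) := by
    have h4 : 1 + 4 * (c ^ 2 - 1 / 4) = (2 * c) ^ 2 := by ring
    simp only [hf, pPlus, Real.cos_zero, h4]
    rw [Real.sqrt_sq (by positivity)]
    congr 1; ring
  have hfφ : f φ = p := by
    simp only [hf, hcos, hwdef]
    rw [show 1 / 2 + (p ^ 2 - 1 / 2) = p ^ 2 by ring, Real.sqrt_sq hp.le]
  have hcospos : ∀ x ∈ Ioo 0 φ, 0 < Real.cos x := fun x hx =>
    Real.cos_pos_of_mem_Ioo ⟨by linarith [hx.1, Real.pi_pos], by linarith [hx.2]⟩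
  have hsinpos : ∀ x ∈ Ioo 0 φ, 0 < Real.sin x := fun x hx =>
    Real.sin_pos_of_pos_of_lt_pi hx.1 (by linarith [hx.2, Real.pi_pos])
  have hpos : ∀ x ∈ Ioo 0 φ, 0 < 1 / 2 + c * Real.cos x := fun x hx => by
    have := mul_pos hc0 (hcospos x hx); linarith
  have key := integral_Icc_deriv_smul_of_deriv_nonpos (f := f) (a := 0) (b := φ) (g := g)
    (f' := fun x => (c * -Real.sin x) / (2 * Real.sqrt (1 / 2 + c * Real.cos x)))
    (by simp only [hf]; fun_prop)
    (fun x hx => (((Real.hasDerivAt_cos x).const_mul c).const_add (1 / 2)).sqrt (hpos x hx).ne')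
    (fun x hx => by
      have := hsinpos x hx
      have h3 : 0 ≤ c * Real.sin x := by positivity
      exact div_nonpos_of_nonpos_of_nonneg (by linarith) (by positivity)) hφ0.le
  have hle : p ≤ pPlus (c ^ 2 - 1 / 4) := by
    rw [← hf0, ← hfφ]
    apply Real.sqrt_le_sqrt
    rw [hcos, Real.cos_zero]
    have : w ≤ c := by
      rw [hc]; exact Real.le_sqrt_of_sq_le (by nlinarith)
    linarith
  rw [hf0, hfφ] at key
  unfold Tplus
  rw [hE, intervalIntegral.integral_of_le hle, ← integral_Icc_eq_integral_Ioc,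
    intervalIntegral.integral_of_le hφ0.le]
  change ∫ u in Icc p _, g u = _
  rw [← neg_eq_iff_eq_neg.2 key, ← integral_neg, integral_Icc_eq_integral_Ioo,
    integral_Ioc_eq_integral_Ioo]
  refine setIntegral_congr_fun measurableSet_Ioo fun x hx => ?_
  have hs := hsinpos x hx
  have hp' := hpos x hx
  have hcs := hcospos x hx
  have hsq : Real.sqrt (1 / 2 + c * Real.cos x) ^ 2 = 1 / 2 + c * Real.cos x :=
    Real.sq_sqrt hp'.le
  have hA : c ^ 2 - 1 / 4 + A (f x) = (c * Real.sin x) ^ 2 := by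
    simp only [hf, A, hsq]
    have := Real.sin_sq_add_cos_sq x
    linear_combination (-c ^ 2) * this
  have hsr : 0 < Real.sqrt (1 / 2 + c * Real.cos x) := Real.sqrt_pos.2 hp'
  simp only [hg, hA, smul_eq_mul, polarRadius]
  rw [Real.sqrt_sq (by positivity), abs_of_pos (by positivity)]
  field_simp

lemma hasDerivAt_integral_polarRadius {c : ℝ} (hc : 0 < c) (φ : ℝ) :
    HasDerivAt (fun c => ∫ x in (0 : ℝ)..φ, 1 / (2 * polarRadius c x))
      (-(1 / 4) * angularIntegral c φ) c := by
  have hcont : ∀ c, Continuous fun x => polarRadius c x := fun c =>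
    continuous_polarRadius.comp (by fun_prop : Continuous fun x : ℝ => (c, x))
  have hF : ∀ c, Continuous fun x => 1 / (2 * polarRadius c x) := fun c =>
    continuous_const.div (continuous_const.mul (hcont c))
      fun x => (mul_pos two_pos (polarRadius_pos c x)).ne'
  have hF' : ∀ c, Continuous fun x => -(1 / 4) * (|Real.cos x| / polarRadius c x ^ 3) := fun c =>
    continuous_const.mul (Real.continuous_cos.abs.div ((hcont c).pow 3)
      fun x => (pow_pos (polarRadius_pos c x) 3).ne')
  have h := (intervalIntegral.hasDerivAt_integral_of_dominated_loc_of_deriv_le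
    (F := fun c x => 1 / (2 * polarRadius c x))
    (F' := fun c x => -(1 / 4) * (|Real.cos x| / polarRadius c x ^ 3))
    (x₀ := c) (a := 0) (b := φ) (μ := volume) (s := Ioi 0)
    (bound := fun _ => 1 / 4 * (1 / Real.sqrt (1 / 2) ^ 3)) (Ioi_mem_nhds hc)
    (Eventually.of_forall fun c => (hF c).aestronglyMeasurable)
    ((hF c).intervalIntegrable _ _) (hF' c).aestronglyMeasurable
    (Eventually.of_forall fun x _ c _ => ?_) (by simp)
    (Eventually.of_forall fun x _ c hc => ?_)).2
  · rwa [intervalIntegral.integral_const_mul] at h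
  · have h1 := polarRadius_pos c x
    have h2 : Real.sqrt (1 / 2) ≤ polarRadius c x :=
      Real.sqrt_le_sqrt (by have := abs_nonneg (c * Real.cos x); linarith)
    rw [norm_mul, Real.norm_of_nonneg (r := |Real.cos x| / polarRadius c x ^ 3) (by positivity)]
    have h3 : ‖(-(1 / 4) : ℝ)‖ = 1 / 4 := by norm_num
    rw [h3]
    gcongr
    exact Real.abs_cos_le_one x
  · have hc' : (0 : ℝ) < c := hc
    have heq : (fun c => 1 / (2 * polarRadius c x)) =ᶠ[𝓝 c]
        fun c => 1 / (2 * Real.sqrt (1 / 2 + c * |Real.cos x|)) := by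
      filter_upwards [Ioi_mem_nhds hc'] with y hy
      rw [polarRadius, abs_mul, abs_of_pos (show (0 : ℝ) < y from hy)]
    have hpos : 0 < 1 / 2 + c * |Real.cos x| := by positivity
    have hs : 0 < Real.sqrt (1 / 2 + c * |Real.cos x|) := Real.sqrt_pos.2 hpos
    have hd := ((((hasDerivAt_id c).mul_const |Real.cos x|).const_add (1 / 2)).sqrt
      hpos.ne').const_mul 2 |>.inv (by simp only [id]; positivity)
    have hd' := hd.congr_of_eventuallyEq (heq.trans (Eventually.of_forall fun y => by simp))
    convert hd' using 1
    rw [polarRadius, abs_mul, abs_of_pos hc']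
    simp only [id]
    field_simp
    ring

lemma continuous_angularIntegrand :
    Continuous fun v : ℝ × ℝ => |Real.cos v.2| / polarRadius v.1 v.2 ^ 3 :=
  (Real.continuous_cos.comp continuous_snd).abs.div (continuous_polarRadius.pow 3)
    fun v => (pow_pos (polarRadius_pos v.1 v.2) 3).ne'

lemma continuous_angularIntegral : Continuous fun v : ℝ × ℝ => angularIntegral v.1 v.2 :=
  intervalIntegral.continuous_parametric_primitive_of_continuous
    (f := fun c x => |Real.cos x| / polarRadius c x ^ 3) continuous_angularIntegrand

lemma intervalIntegrable_angularIntegrand (c a b : ℝ) :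
    IntervalIntegrable (fun x => |Real.cos x| / polarRadius c x ^ 3) volume a b :=
  (continuous_angularIntegrand.comp
    (by fun_prop : Continuous fun x : ℝ => (c, x))).intervalIntegrable _ _

lemma hasDerivAt_Tplus_s12 {p q : ℝ} (hp : 0 < p) (hw : 0 < p ^ 2 - 1 / 2) (hq : 0 < q) :
    HasDerivAt (fun q => Tplus p q) (periodDeriv (p ^ 2 - 1 / 2) q) q := by
  set w := p ^ 2 - 1 / 2 with hwdef
  set c := Real.sqrt (w ^ 2 + q ^ 2) with hc
  set φ := polarAngle w q with hφ
  have hc0 : 0 < c := by positivity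
  have hc2 : c ^ 2 = w ^ 2 + q ^ 2 := Real.sq_sqrt (by positivity)
  have hcont : Continuous fun v : ℝ × ℝ => 1 / (2 * polarRadius v.1 v.2) :=
    continuous_const.div (continuous_const.mul continuous_polarRadius)
      fun v => (mul_pos two_pos (polarRadius_pos v.1 v.2)).ne'
  have hstrict := hasStrictFDerivAt_uncurry_coprod (𝕜 := ℝ) (u := (c, φ))
    (f := fun c φ => ∫ x in (0 : ℝ)..φ, 1 / (2 * polarRadius c x))
    (f₁ := fun c φ => ContinuousLinearMap.toSpanSingleton ℝ (-(1 / 4) * angularIntegral c φ))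
    (f₂ := fun c φ => ContinuousLinearMap.toSpanSingleton ℝ (1 / (2 * polarRadius c φ)))
    (by
      filter_upwards [continuous_fst.continuousAt.preimage_mem_nhds (Ioi_mem_nhds hc0)] with v hv
      exact (hasDerivAt_integral_polarRadius hv v.2).hasFDerivAt)
    (Eventually.of_forall fun v => by
      have hv : Continuous fun x => 1 / (2 * polarRadius v.1 x) :=
        hcont.comp (by fun_prop : Continuous fun x : ℝ => (v.1, x))
      exact (hv.integral_hasStrictDerivAt 0 v.2).hasDerivAt.hasFDerivAt)
    ((ContinuousLinearMap.toSpanSingletonCLE (𝕜 := ℝ) (E := ℝ)).continuous.comp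
      (continuous_const.mul continuous_angularIntegral)).continuousAt
    ((ContinuousLinearMap.toSpanSingletonCLE (𝕜 := ℝ) (E := ℝ)).continuous.comp
      hcont).continuousAt
  have hdc : HasDerivAt (fun q => Real.sqrt (w ^ 2 + q ^ 2)) (q / c) q := by
    refine (((hasDerivAt_pow 2 q).const_add (w ^ 2)).sqrt (by positivity)).congr_deriv ?_
    rw [← hc]; field_simp; norm_num
  have hdφ : HasDerivAt (fun q => polarAngle w q) (w / c ^ 2) q := by
    refine (((hasDerivAt_inv hq.ne').const_mul w).arctan.const_sub (π / 2)).congr_deriv ?_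
    rw [hc2]; field_simp; ring
  have hcomp := hstrict.hasFDerivAt.comp_hasDerivAt q (hdc.prodMk hdφ)
  have heq : (fun q => Tplus p q) =ᶠ[𝓝 q] fun q => ∫ x in (0 : ℝ)..polarAngle w q,
      1 / (2 * polarRadius (Real.sqrt (w ^ 2 + q ^ 2)) x) := by
    filter_upwards [Ioi_mem_nhds hq] with y hy
    exact Tplus_eq_integral hp hw hy
  refine HasDerivAt.congr_of_eventuallyEq ?_ heq
  refine HasDerivAt.congr_deriv (f := fun q => ∫ x in (0 : ℝ)..polarAngle w q,
    1 / (2 * polarRadius (Real.sqrt (w ^ 2 + q ^ 2)) x)) hcomp ?_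
  have hr : polarRadius c φ = Real.sqrt (1 / 2 + w) := by
    rw [polarRadius, sqrt_mul_cos_polarAngle hq, abs_of_pos hw]
  have hr0 : 0 < Real.sqrt (1 / 2 + w) := by positivity
  change q / c * (-(1 / 4) * angularIntegral c φ) + w / c ^ 2 * (1 / (2 * polarRadius c φ)) = _
  rw [hr, periodDeriv, ← hc, ← hφ, ← hc2]
  field_simp
  ring

lemma angularIntegral_anti {c₁ c₂ φ₁ φ₂ : ℝ} (hc₁ : 0 ≤ c₁) (hc : c₁ ≤ c₂) (hφ₂ : 0 ≤ φ₂)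
    (hφ : φ₂ ≤ φ₁) : angularIntegral c₂ φ₂ ≤ angularIntegral c₁ φ₁ := by
  have h1 : angularIntegral c₂ φ₂ ≤ angularIntegral c₁ φ₂ := by
    refine intervalIntegral.integral_mono_on hφ₂ (intervalIntegrable_angularIntegrand _ _ _)
      (intervalIntegrable_angularIntegrand _ _ _) fun x _ => ?_
    have h2 : polarRadius c₁ x ≤ polarRadius c₂ x := by
      unfold polarRadius
      rw [abs_mul, abs_mul, abs_of_nonneg hc₁, abs_of_nonneg (hc₁.trans hc)]
      gcongr
    have := polarRadius_pos c₁ x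
    gcongr
  have h3 : angularIntegral c₁ φ₂ ≤ angularIntegral c₁ φ₁ :=
    intervalIntegral.integral_mono_interval le_rfl hφ₂ hφ
      (Eventually.of_forall fun x => by have := polarRadius_pos c₁ x; positivity)
      (intervalIntegrable_angularIntegrand _ _ _)
  exact h1.trans h3

lemma angularIntegral_le {c φ : ℝ} (hφ₀ : 0 ≤ φ) (hφ : φ ≤ π / 2) :
    angularIntegral c φ ≤ 3 * Real.sin φ := by
  have h : angularIntegral c φ ≤ ∫ x in (0 : ℝ)..φ, 3 * Real.cos x := by
    refine intervalIntegral.integral_mono_on hφ₀ (intervalIntegrable_angularIntegrand _ _ _)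
      ((by fun_prop : Continuous fun x => 3 * Real.cos x).intervalIntegrable _ _) fun x hx => ?_
    have hx0 : 0 ≤ Real.cos x :=
      Real.cos_nonneg_of_mem_Icc ⟨by linarith [hx.1, Real.pi_pos], by linarith [hx.2]⟩
    have hr : (7 / 10 : ℝ) ≤ polarRadius c x :=
      Real.le_sqrt_of_sq_le (by have := abs_nonneg (c * Real.cos x); linarith)
    have hr3 : (7 / 10 : ℝ) ^ 3 ≤ polarRadius c x ^ 3 := by gcongr
    rw [abs_of_nonneg hx0, div_le_iff₀ (pow_pos (polarRadius_pos c x) 3)]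
    nlinarith
  simpa using h

lemma angularIntegral_pos (c : ℝ) : 0 < angularIntegral c (π / 2) := by
  refine intervalIntegral.intervalIntegral_pos_of_pos_on
    (intervalIntegrable_angularIntegrand _ _ _) (fun x hx => ?_) (by positivity)
  have := polarRadius_pos c x
  have : 0 < Real.cos x := Real.cos_pos_of_mem_Ioo ⟨by linarith [hx.1, Real.pi_pos], hx.2⟩
  positivity

lemma le_of_periodDeriv_nonpos {w q : ℝ} (hw : 0 ≤ w) (hw' : w ≤ 1 / 2) (hq : 0 < q)
    (h : periodDeriv w q ≤ 0) : 2 * w ≤ 3 * q ^ 2 := by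
  have hI := angularIntegral_le (c := Real.sqrt (w ^ 2 + q ^ 2)) (polarAngle_pos w q).le
    (polarAngle_le hw hq)
  have hsin := sqrt_mul_sin_polarAngle (w := w) hq
  unfold periodDeriv at h
  set c := Real.sqrt (w ^ 2 + q ^ 2) with hc
  have hc0 : 0 < c := by positivity
  have hc2 : c ^ 2 = w ^ 2 + q ^ 2 := Real.sq_sqrt (by positivity)
  set r := Real.sqrt (1 / 2 + w) with hr
  have hr0 : 0 < r := by positivity
  have hr1 : r ≤ 1 := Real.sqrt_le_one.2 (by linarith)
  set I := angularIntegral c (polarAngle w q)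
  rw [← hc2, sub_nonpos, div_mul_eq_mul_div, div_le_div_iff₀ (by positivity) (by positivity)] at h
  have h1 : 2 * w ≤ q * (c * I) * r := by
    have : (2 * c) * (2 * w) ≤ (2 * c) * (q * (c * I) * r) := by linarith
    exact le_of_mul_le_mul_left this (by positivity)
  have h2 : c * I ≤ 3 * q := by nlinarith
  have h3 : q * (c * I) * r ≤ q * (3 * q) * r := by gcongr
  have h4 : q * (3 * q) * r ≤ q * (3 * q) * 1 := by gcongr
  linarith

lemma angularIntegral_eq_of_periodDeriv_eq_zero {w q : ℝ} (hw : 0 ≤ w) (hq : 0 < q)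
    (h : periodDeriv w q = 0) :
    angularIntegral (Real.sqrt (w ^ 2 + q ^ 2)) (polarAngle w q) =
      2 * w / (q * Real.sqrt (w ^ 2 + q ^ 2) * Real.sqrt (1 / 2 + w)) := by
  unfold periodDeriv at h
  have hc0 : 0 < Real.sqrt (w ^ 2 + q ^ 2) := by positivity
  have hc2 : w ^ 2 + q ^ 2 = Real.sqrt (w ^ 2 + q ^ 2) ^ 2 := (Real.sq_sqrt (by positivity)).symm
  generalize angularIntegral (Real.sqrt (w ^ 2 + q ^ 2)) (polarAngle w q) = I at h ⊢
  nth_rewrite 1 [hc2] at h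
  have hr0 : 0 < Real.sqrt (1 / 2 + w) := by positivity
  field_simp at h ⊢
  linarith

lemma mul_radii_lt {s w₁ w₂ : ℝ} (hs : 0 < s) (hw₁ : 0 < w₁) (hw : w₁ < w₂) (hw₂ : 2 * w₂ ≤ s) :
    w₁ ^ 2 * ((w₂ ^ 2 + s ^ 2 * (1 / 4 - w₂ ^ 2)) * (1 / 2 + w₂)) <
      w₂ ^ 2 * ((w₁ ^ 2 + s ^ 2 * (1 / 4 - w₁ ^ 2)) * (1 / 2 + w₁)) := by
  have hw₂0 : 0 < w₂ := hw₁.trans hw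
  have hprod : 4 * (w₁ * w₂) ≤ s ^ 2 := by nlinarith
  have h1 : 0 ≤ s ^ 2 / 4 - (1 - s ^ 2) * (w₁ * w₂) := by
    nlinarith [mul_pos (mul_pos hw₁ hw₂0) (mul_pos hs hs)]
  have h2 : 0 < (w₂ - w₁) * (w₁ * w₂ * (s ^ 2 / 4 - (1 - s ^ 2) * (w₁ * w₂)) +
      s ^ 2 / 4 * ((w₁ + w₂) / 2)) :=
    mul_pos (sub_pos.2 hw) (by positivity)
  linarith

/-- Along each curve `q = s √(1/4 − w²)` the derivative of the period has at most one zero. -/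
lemma not_two_zeros {s w₁ w₂ : ℝ} (hs : 0 < s) (hs' : s ≤ 1 / 4) (hw₁ : 0 < w₁) (hw : w₁ < w₂)
    (hw₂ : w₂ < 1 / 2) (h₁ : periodDeriv w₁ (s * Real.sqrt (1 / 4 - w₁ ^ 2)) = 0)
    (h₂ : periodDeriv w₂ (s * Real.sqrt (1 / 4 - w₂ ^ 2)) = 0) : False := by
  have hw₂0 : 0 < w₂ := hw₁.trans hw
  have hA₁ : 0 < 1 / 4 - w₁ ^ 2 := by nlinarith
  have hA₂ : 0 < 1 / 4 - w₂ ^ 2 := by nlinarith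
  have hq₁2 : (s * Real.sqrt (1 / 4 - w₁ ^ 2)) ^ 2 = s ^ 2 * (1 / 4 - w₁ ^ 2) := by
    rw [mul_pow, Real.sq_sqrt hA₁.le]
  have hq₂2 : (s * Real.sqrt (1 / 4 - w₂ ^ 2)) ^ 2 = s ^ 2 * (1 / 4 - w₂ ^ 2) := by
    rw [mul_pow, Real.sq_sqrt hA₂.le]
  have hq₁ : 0 < s * Real.sqrt (1 / 4 - w₁ ^ 2) := mul_pos hs (Real.sqrt_pos.2 hA₁)
  have hq₂ : 0 < s * Real.sqrt (1 / 4 - w₂ ^ 2) := mul_pos hs (Real.sqrt_pos.2 hA₂)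
  generalize s * Real.sqrt (1 / 4 - w₁ ^ 2) = q₁ at *
  generalize s * Real.sqrt (1 / 4 - w₂ ^ 2) = q₂ at *
  have hb₂ := le_of_periodDeriv_nonpos hw₂0.le hw₂.le hq₂ h₂.le
  have hw2s : 2 * w₂ ≤ s := by nlinarith [mul_pos hs hs, sq_nonneg (s * w₂)]
  have hqq : q₂ ≤ q₁ := by
    rw [← abs_of_pos hq₁, ← abs_of_pos hq₂, ← sq_le_sq, hq₁2, hq₂2]
    gcongr
  have e₁ := angularIntegral_eq_of_periodDeriv_eq_zero hw₁.le hq₁ h₁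
  have e₂ := angularIntegral_eq_of_periodDeriv_eq_zero hw₂0.le hq₂ h₂
  have hcc : w₁ ^ 2 + q₁ ^ 2 ≤ w₂ ^ 2 + q₂ ^ 2 := by
    rw [hq₁2, hq₂2]
    nlinarith [mul_nonneg (sub_nonneg.2 (show w₁ ^ 2 ≤ w₂ ^ 2 by gcongr))
      (show 0 ≤ 1 - s ^ 2 by nlinarith)]
  have hang : polarAngle w₂ q₂ ≤ polarAngle w₁ q₁ := by
    unfold polarAngle
    apply sub_le_sub_left
    apply Real.arctan_strictMono.monotone
    gcongr
  have hanti := angularIntegral_anti (Real.sqrt_nonneg (w₁ ^ 2 + q₁ ^ 2))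
    (Real.sqrt_le_sqrt hcc) (polarAngle_pos w₂ q₂).le hang
  rw [e₁, e₂, div_le_div_iff₀ (by positivity) (by positivity)] at hanti
  have hsq := pow_le_pow_left₀ (by positivity) hanti 2
  simp only [mul_pow] at hsq
  rw [Real.sq_sqrt (by positivity), Real.sq_sqrt (by positivity), Real.sq_sqrt (by positivity),
    Real.sq_sqrt (by positivity)] at hsq
  have hq2 : q₂ ^ 2 ≤ q₁ ^ 2 := by gcongr
  have hkey := mul_lt_mul' hq2 (mul_radii_lt hs hw₁ hw hw2s) (by positivity) (by positivity)
  rw [← hq₁2, ← hq₂2] at hkey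
  linarith

/-- Along each curve `q = s √(1/4 − w²)` the derivative of the period has a zero. -/
lemma exists_zero {s : ℝ} (hs : 0 < s) (hs' : s ≤ 1 / 4) :
    ∃ w ∈ Ioo (0 : ℝ) (1 / 8), periodDeriv w (s * Real.sqrt (1 / 4 - w ^ 2)) = 0 := by
  have hA : ∀ w ∈ Icc (0 : ℝ) (1 / 8), 0 < 1 / 4 - w ^ 2 := fun w hw => by
    nlinarith [hw.1, hw.2]
  have hq : ∀ w ∈ Icc (0 : ℝ) (1 / 8), 0 < s * Real.sqrt (1 / 4 - w ^ 2) := fun w hw =>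
    mul_pos hs (Real.sqrt_pos.2 (hA w hw))
  have hcont : ContinuousOn (fun w => periodDeriv w (s * Real.sqrt (1 / 4 - w ^ 2)))
      (Icc 0 (1 / 8)) := by
    have hqc : ContinuousOn (fun w => s * Real.sqrt (1 / 4 - w ^ 2)) (Icc 0 (1 / 8)) := by fun_prop
    have hcc : ContinuousOn (fun w => Real.sqrt (w ^ 2 + (s * Real.sqrt (1 / 4 - w ^ 2)) ^ 2))
        (Icc 0 (1 / 8)) := by fun_prop
    have hφc : ContinuousOn (fun w => polarAngle w (s * Real.sqrt (1 / 4 - w ^ 2)))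
        (Icc 0 (1 / 8)) := by
      unfold polarAngle
      exact continuousOn_const.sub (Real.continuous_arctan.comp_continuousOn
        (continuousOn_id.div hqc fun w hw => (hq w hw).ne'))
    have hIc := continuous_angularIntegral.comp_continuousOn (hcc.prodMk hφc)
    have hfst : ContinuousOn (fun w => w / (2 * (w ^ 2 + (s * Real.sqrt (1 / 4 - w ^ 2)) ^ 2) *
        Real.sqrt (1 / 2 + w))) (Icc 0 (1 / 8)) :=
      continuousOn_id.div (by fun_prop) fun w hw => by
        have := hq w hw
        have := hw.1
        positivity
    have hsnd : ContinuousOn (fun w => s * Real.sqrt (1 / 4 - w ^ 2) /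
        (4 * Real.sqrt (w ^ 2 + (s * Real.sqrt (1 / 4 - w ^ 2)) ^ 2))) (Icc 0 (1 / 8)) :=
      hqc.div (by fun_prop) fun w hw => by
        have := hq w hw
        positivity
    exact hfst.sub (hsnd.mul hIc)
  have h0 : periodDeriv 0 (s * Real.sqrt (1 / 4 - 0 ^ 2)) < 0 := by
    have hq0 := hq 0 ⟨le_rfl, by norm_num⟩
    have hφ : polarAngle 0 (s * Real.sqrt (1 / 4 - 0 ^ 2)) = π / 2 := by simp [polarAngle]
    rw [periodDeriv, hφ, zero_div, zero_sub, neg_lt_zero]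
    exact mul_pos (by positivity) (angularIntegral_pos _)
  have h1 : 0 < periodDeriv (1 / 8) (s * Real.sqrt (1 / 4 - (1 / 8) ^ 2)) := by
    by_contra! h
    have hmem : (1 / 8 : ℝ) ∈ Icc (0 : ℝ) (1 / 8) := ⟨by norm_num, le_rfl⟩
    have := le_of_periodDeriv_nonpos (by norm_num) (by norm_num) (hq _ hmem) h
    rw [mul_pow, Real.sq_sqrt (hA _ hmem).le] at this
    nlinarith
  obtain ⟨w, hw, hw0⟩ := intermediate_value_Ioo (by norm_num) hcont ⟨h0, h1⟩
  exact ⟨w, hw, hw0⟩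

lemma deriv_Tplus_eq {s p : ℝ} (hs : 0 < s) (hp : pstar < p) (hp' : p < 1) :
    0 < p ^ 2 - 1 / 2 ∧ p ^ 2 - 1 / 2 < 1 / 2 ∧
    deriv (fun q => Tplus p q) (s * Real.sqrt (A p)) =
      periodDeriv (p ^ 2 - 1 / 2) (s * Real.sqrt (1 / 4 - (p ^ 2 - 1 / 2) ^ 2)) := by
  have hst : 0 < pstar := by unfold pstar; positivity
  have hst2 : pstar ^ 2 = 1 / 2 := by
    rw [pstar, div_pow, Real.sq_sqrt (by norm_num)]; norm_num
  have hw : 0 < p ^ 2 - 1 / 2 := by nlinarith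
  have hw' : p ^ 2 - 1 / 2 < 1 / 2 := by nlinarith
  have hA : A p = 1 / 4 - (p ^ 2 - 1 / 2) ^ 2 := by unfold A; ring
  have hA0 : 0 < 1 / 4 - (p ^ 2 - 1 / 2) ^ 2 := by nlinarith
  refine ⟨hw, hw', ?_⟩
  rw [hA]
  exact (hasDerivAt_Tplus_s12 (hst.trans hp) hw (mul_pos hs (Real.sqrt_pos.2 hA0))).deriv

/-- fix `N ≥ 2` and let `p⋆⋆ ∈ (p⋆, √(2/3))` be such that for every
`p₀ ∈ (p⋆, p⋆⋆)` the map `q₀ ↦ T₊(p₀,q₀)` has exactly one critical point in `(0, √A(p₀))`,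
while for `p₀ ∈ [p⋆⋆, 1)` it has none. Then there is exactly one `p₀ ∈ (p⋆, p⋆⋆)` whose
critical point is `q_max(p₀) = (1/(2N))√A(p₀)`; equivalently, exactly one `p₀ ∈ (p⋆, p⋆⋆)`
with `∂T₊/∂q₀(p₀, (1/(2N))√A(p₀)) = 0`. -/
theorem unique_bifurcation_point (N : ℕ) (hN : 2 ≤ N)
    (pss : ℝ) (hpss : pss ∈ Set.Ioo pstar (Real.sqrt (2 / 3)))
    (hone : ∀ p₀ ∈ Set.Ioo pstar pss,
      ∃! q₀ : ℝ, q₀ ∈ Set.Ioo 0 (Real.sqrt (A p₀)) ∧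
        deriv (fun q => Tplus p₀ q) q₀ = 0)
    (hnone : ∀ p₀ ∈ Set.Ico pss 1, ∀ q₀ ∈ Set.Ioo (0 : ℝ) (Real.sqrt (A p₀)),
      deriv (fun q => Tplus p₀ q) q₀ ≠ 0) :
    ∃! p₀ : ℝ, p₀ ∈ Set.Ioo pstar pss ∧
      deriv (fun q => Tplus p₀ q) (1 / (2 * (N : ℝ)) * Real.sqrt (A p₀)) = 0 := by
  have hN' : (2 : ℝ) ≤ N := by exact_mod_cast hN
  obtain ⟨s, hsdef⟩ : ∃ s : ℝ, s = 1 / (2 * (N : ℝ)) := ⟨_, rfl⟩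
  have hs : 0 < s := by rw [hsdef]; positivity
  have hs' : s ≤ 1 / 4 := by
    rw [hsdef, div_le_div_iff₀ (by positivity) (by norm_num)]; linarith
  rw [← hsdef]
  have hpss1 : pss < 1 := hpss.2.trans_le (Real.sqrt_le_one.2 (by norm_num))
  have hst : 0 < pstar := by unfold pstar; positivity
  obtain ⟨w, hw, hw0⟩ := exists_zero hs hs'
  have hp2 : Real.sqrt (1 / 2 + w) ^ 2 = 1 / 2 + w := Real.sq_sqrt (by linarith [hw.1])
  have hp : pstar < Real.sqrt (1 / 2 + w) := by
    rw [pstar, ← Real.sqrt_one, ← Real.sqrt_div zero_le_one]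
    exact Real.sqrt_lt_sqrt (by norm_num) (by linarith [hw.1])
  have hp1 : Real.sqrt (1 / 2 + w) < 1 := by
    rw [Real.sqrt_lt' one_pos]; linarith [hw.2]
  have hD : deriv (fun q => Tplus (Real.sqrt (1 / 2 + w)) q)
      (s * Real.sqrt (A (Real.sqrt (1 / 2 + w)))) = 0 := by
    rw [(deriv_Tplus_eq hs hp hp1).2.2, hp2, add_sub_cancel_left, hw0]
  have hApos : 0 < Real.sqrt (A (Real.sqrt (1 / 2 + w))) := by
    apply Real.sqrt_pos.2
    rw [A, hp2]
    nlinarith [hw.1, hw.2]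
  have hlt : Real.sqrt (1 / 2 + w) < pss := by
    by_contra! hge
    exact hnone _ ⟨hge, hp1⟩ _ ⟨mul_pos hs hApos, by nlinarith⟩ hD
  refine ⟨_, ⟨⟨hp, hlt⟩, hD⟩, ?_⟩
  rintro y ⟨⟨hy, hy'⟩, hyD⟩
  obtain ⟨hy1, hy2, hy3⟩ := deriv_Tplus_eq hs hy (hy'.trans hpss1)
  rw [hy3] at hyD
  have heq : y ^ 2 - 1 / 2 = w := by
    rcases lt_trichotomy (y ^ 2 - 1 / 2) w with h | h | h
    · exact (not_two_zeros hs hs' hy1 h (by linarith [hw.2]) hyD hw0).elim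
    · exact h
    · exact (not_two_zeros hs hs' hw.1 h hy2 hw0 hyD).elim
  rw [← heq, add_sub_cancel, Real.sqrt_sq (hst.trans hy).le]
end

section
/- Fix an integer N ≥ 2 and define ℱ(p₀) = (2p₀² − 1)p₀² − q₀² + 3q₀p₀³ ∫_{p₀}^{p₊} √(E₀(p₀) + A(u))/u⁴ du, where q₀ = (1/(2N))√A(p₀), E₀(p₀) = q₀² − A(p₀), and p₊ is the turning point for energy E₀(p₀). Then at every zero p₀ ∈ (p_*, 1) of ℱ one has ℱ'(p₀) > 0; consequently ℱ has at most one zero in (p_*, 1). -/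
open Real MeasureTheory Set Filter Topology

/-- `ℱ(p₀) = (2p₀²−1)p₀² − q₀² + 3q₀p₀³ ∫_{p₀}^{p₊} √(E₀(p₀)+A(u))/u⁴ du` with
`q₀ = (1/(2N))√A(p₀)` and `E₀(p₀) = q₀² − A(p₀)`. -/
noncomputable def calF (N : ℕ) (p₀ : ℝ) : ℝ :=
  (2 * p₀ ^ 2 - 1) * p₀ ^ 2 - (1 / (2 * (N : ℝ)) * Real.sqrt (A p₀)) ^ 2 +
    3 * (1 / (2 * (N : ℝ)) * Real.sqrt (A p₀)) * p₀ ^ 3 *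
      ∫ u in p₀..pPlus ((1 / (2 * (N : ℝ)) * Real.sqrt (A p₀)) ^ 2 - A p₀),
        Real.sqrt (((1 / (2 * (N : ℝ)) * Real.sqrt (A p₀)) ^ 2 - A p₀) + A u) / u ^ 4

theorem A_pPlus_neg {v : ℝ} (hv : v ≤ 1 / 4) : A (pPlus (-v)) = v := by
  have hr := Real.sq_sqrt (show (0 : ℝ) ≤ 1 + 4 * -v by linarith)
  have h2 : pPlus (-v) ^ 2 = (1 + √(1 + 4 * -v)) / 2 := Real.sq_sqrt (by positivity)
  rw [A, h2]
  linear_combination -hr / 4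

theorem pPlus_pos (E : ℝ) : 0 < pPlus E := Real.sqrt_pos.2 (by positivity)

theorem two_mul_sq_sub_one_pos {p : ℝ} (hp : p ∈ Ioo pstar 1) : 0 < p ∧ 0 < 2 * p ^ 2 - 1 := by
  have hs : (0 : ℝ) < pstar := by rw [pstar]; positivity
  have h2 : pstar ^ 2 = 1 / 2 := by rw [pstar, div_pow, Real.sq_sqrt (by norm_num)]; norm_num
  have := hp.1
  exact ⟨hs.trans this, by nlinarith⟩

theorem sqrt_one_sub_four_mul_A {p : ℝ} (hp : p ∈ Ioo pstar 1) :
    √(1 + 4 * -A p) = 2 * p ^ 2 - 1 := by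
  rw [← Real.sqrt_sq (two_mul_sq_sub_one_pos hp).2.le, A]
  congr 1
  ring

theorem pPlus_neg_A {p : ℝ} (hp : p ∈ Ioo pstar 1) : pPlus (-A p) = p := by
  rw [pPlus, sqrt_one_sub_four_mul_A hp, ← Real.sqrt_sq (two_mul_sq_sub_one_pos hp).1.le]
  congr 1
  rw [Real.sqrt_sq (two_mul_sq_sub_one_pos hp).1.le]
  ring

theorem A_mem_Ioo {p : ℝ} (hp : p ∈ Ioo pstar 1) : A p ∈ Ioo (0 : ℝ) (1 / 4) := by
  obtain ⟨h0, h1⟩ := two_mul_sq_sub_one_pos hp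
  have h2 : 0 < 1 - p ^ 2 := by nlinarith [hp.2]
  refine ⟨by rw [A]; positivity, ?_⟩
  rw [A]
  nlinarith [pow_pos h1 2]

/-- The factor `|du/dv| / u⁴` produced by the substitution `v = A u` on the branch `u > p⋆`. -/
noncomputable def branchWeight (v : ℝ) : ℝ := 1 / (2 * pPlus (-v) ^ 5 * √(1 + 4 * -v))

/-- The derivative of `branchWeight`. -/
noncomputable def branchWeightDeriv (v : ℝ) : ℝ :=
  branchWeight v * (5 / (2 * pPlus (-v) ^ 2 * √(1 + 4 * -v)) + 2 / √(1 + 4 * -v) ^ 2)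

theorem hasDerivAt_sqrt_discrim {v : ℝ} (hv : v < 1 / 4) :
    HasDerivAt (fun v => √(1 + 4 * -v)) (-2 / √(1 + 4 * -v)) v := by
  have h0 : (0 : ℝ) < 1 + 4 * -v := by linarith
  have hr := Real.sqrt_pos.2 h0
  convert (((hasDerivAt_id v).neg.const_mul 4).const_add 1).sqrt h0.ne' using 1
  simp only [Pi.neg_apply, id]
  field_simp
  norm_num

theorem hasDerivAt_pPlus_neg {v : ℝ} (hv : v < 1 / 4) :
    HasDerivAt (fun v => pPlus (-v)) (-1 / (2 * pPlus (-v) * √(1 + 4 * -v))) v := by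
  have h0 : (0 : ℝ) < 1 + 4 * -v := by linarith
  have hr := Real.sqrt_pos.2 h0
  have hp := pPlus_pos (-v)
  have h1 : (1 + √(1 + 4 * -v)) / 2 ≠ 0 := by positivity
  refine ((((hasDerivAt_sqrt_discrim hv).const_add 1).div_const 2).sqrt h1).congr_deriv ?_
  rw [← pPlus]
  field_simp

theorem hasDerivAt_branchWeight {v : ℝ} (hv : v < 1 / 4) :
    HasDerivAt branchWeight (branchWeightDeriv v) v := by
  have h0 : (0 : ℝ) < 1 + 4 * -v := by linarith
  have hr := Real.sqrt_pos.2 h0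
  have hp := pPlus_pos (-v)
  have h1 : 2 * pPlus (-v) ^ 5 * √(1 + 4 * -v) ≠ 0 := by positivity
  refine (((((hasDerivAt_pPlus_neg hv).pow 5).const_mul 2).mul
    (hasDerivAt_sqrt_discrim hv)).inv h1).congr_deriv ?_ |>.congr_of_eventuallyEq
      (Eventually.of_forall fun x => by simp [branchWeight])
  simp only [branchWeightDeriv, branchWeight, Pi.mul_apply, Pi.pow_apply]
  field_simp
  ring

theorem continuousOn_branchWeight : ContinuousOn branchWeight (Iio (1 / 4)) := fun _ hv =>
  (hasDerivAt_branchWeight hv).continuousAt.continuousWithinAt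

theorem continuousOn_branchWeightDeriv : ContinuousOn branchWeightDeriv (Iio (1 / 4)) := by
  intro v hv
  have h0 : (0 : ℝ) < 1 + 4 * -v := by linarith [show v < 1 / 4 from hv]
  have hr := Real.sqrt_pos.2 h0
  have hp := pPlus_pos (-v)
  have hcr := (hasDerivAt_sqrt_discrim hv).continuousAt
  have hcp := (hasDerivAt_pPlus_neg hv).continuousAt
  have h1 : 2 * pPlus (-v) ^ 2 * √(1 + 4 * -v) ≠ 0 := by positivity
  have h2 : √(1 + 4 * -v) ^ 2 ≠ 0 := by positivity
  exact ((hasDerivAt_branchWeight hv).continuousAt.mul ((continuousAt_const.div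
    ((continuousAt_const.mul (hcp.pow 2)).mul hcr) h1).add
      (continuousAt_const.div (hcr.pow 2) h2))).continuousWithinAt

theorem branchWeight_nonneg (v : ℝ) : 0 ≤ branchWeight v := by
  have := pPlus_pos (-v)
  rw [branchWeight]
  positivity

theorem branchWeightDeriv_nonneg (v : ℝ) : 0 ≤ branchWeightDeriv v := by
  have := pPlus_pos (-v)
  have := branchWeight_nonneg v
  rw [branchWeightDeriv]
  positivity

theorem monotoneOn_branchWeight : MonotoneOn branchWeight (Iio (1 / 4)) :=
  monotoneOn_of_hasDerivWithinAt_nonneg (convex_Iio _) continuousOn_branchWeight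
    (fun v hv => (hasDerivAt_branchWeight (by rwa [interior_Iio] at hv)).hasDerivWithinAt)
    fun v _ => branchWeightDeriv_nonneg v

theorem mul_affine_mem_Icc {a d t : ℝ} (ha : 0 ≤ a) (hd : d ∈ Icc (0 : ℝ) 1)
    (ht : t ∈ Icc (0 : ℝ) 1) : a * (1 - d + d * t) ∈ Icc 0 a := by
  obtain ⟨hd0, hd1⟩ := hd
  obtain ⟨ht0, ht1⟩ := ht
  have : 0 ≤ d * t := by positivity
  have : d * t ≤ d := mul_le_of_le_one_right hd0 ht1
  exact ⟨mul_nonneg ha (by linarith), mul_le_of_le_one_right ha (by linarith)⟩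

theorem continuousOn_comp_mul_affine {f : ℝ → ℝ} (hf : ContinuousOn f (Iio (1 / 4))) {a d : ℝ}
    (ha : a ∈ Ioo (0 : ℝ) (1 / 4)) (hd : d ∈ Icc (0 : ℝ) 1) :
    ContinuousOn (fun t => f (a * (1 - d + d * t))) (uIcc 0 1) := by
  rw [uIcc_of_le zero_le_one]
  exact hf.comp (by fun_prop) fun t ht => (mul_affine_mem_Icc ha.1.le hd ht).2.trans_lt ha.2

/-- The integral in `calF`, up to a power of `a`, after the substitution
`A u = a * (1 - d + d * t)`. -/
noncomputable def branchIntegral (d a : ℝ) : ℝ :=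
  ∫ t in (0 : ℝ)..1, √t * branchWeight (a * (1 - d + d * t))

/-- The derivative of `branchIntegral d`. -/
noncomputable def branchIntegralDeriv (d a : ℝ) : ℝ :=
  ∫ t in (0 : ℝ)..1, √t * (branchWeightDeriv (a * (1 - d + d * t)) * (1 - d + d * t))

theorem hasDerivAt_branchIntegral {d a : ℝ} (hd : d ∈ Icc (0 : ℝ) 1)
    (ha : a ∈ Ioo (0 : ℝ) (1 / 4)) :
    HasDerivAt (branchIntegral d) (branchIntegralDeriv d a) a := by
  obtain ⟨b, hab, hb⟩ := exists_between ha.2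
  obtain ⟨C, hC⟩ := isCompact_Icc.exists_bound_of_continuousOn
    (continuousOn_branchWeightDeriv.mono fun v (hv : v ∈ Icc 0 b) => hv.2.trans_lt hb)
  have hsqrt : ContinuousOn (fun t : ℝ => √t) (uIcc 0 1) := by fun_prop
  have hint : ∀ x ∈ Ioo (0 : ℝ) (1 / 4), IntervalIntegrable
      (fun t => √t * branchWeight (x * (1 - d + d * t))) volume 0 1 := fun x hx =>
    (hsqrt.mul (continuousOn_comp_mul_affine continuousOn_branchWeight hx hd)).intervalIntegrable
  have hint' : IntervalIntegrable
      (fun t => √t * (branchWeightDeriv (a * (1 - d + d * t)) * (1 - d + d * t))) volume 0 1 :=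
    (hsqrt.mul ((continuousOn_comp_mul_affine continuousOn_branchWeightDeriv ha hd).mul
      (by fun_prop))).intervalIntegrable
  refine (intervalIntegral.hasDerivAt_integral_of_dominated_loc_of_deriv_le
    (s := Ioo 0 b) (bound := fun _ => C)
    (F' := fun x t => √t * (branchWeightDeriv (x * (1 - d + d * t)) * (1 - d + d * t)))
    (Ioo_mem_nhds ha.1 hab) ?_ (hint a ha) ?_ ?_ intervalIntegrable_const ?_).2
  · filter_upwards [Ioo_mem_nhds ha.1 ha.2] with x hx
    exact (intervalIntegrable_iff.1 (hint x hx)).aestronglyMeasurable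
  · exact (intervalIntegrable_iff.1 hint').aestronglyMeasurable
  · refine Eventually.of_forall fun t ht x hx => ?_
    rw [uIoc_of_le zero_le_one] at ht
    have ht' : t ∈ Icc (0 : ℝ) 1 := Ioc_subset_Icc_self ht
    have h1 := mul_affine_mem_Icc hx.1.le hd ht'
    have h2 := mul_affine_mem_Icc zero_le_one hd ht'
    rw [one_mul] at h2
    have h3 := hC _ ⟨h1.1, h1.2.trans hx.2.le⟩
    have h4 : √t ≤ 1 := Real.sqrt_le_one.2 ht.2
    rw [norm_mul, norm_mul, Real.norm_of_nonneg (Real.sqrt_nonneg t), Real.norm_of_nonneg h2.1]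
    exact (mul_le_of_le_one_left (by have := h2.1; positivity) h4).trans
      ((mul_le_of_le_one_right (norm_nonneg _) h2.2).trans h3)
  · refine Eventually.of_forall fun t ht x hx => ?_
    rw [uIoc_of_le zero_le_one] at ht
    have h1 := mul_affine_mem_Icc hx.1.le hd (Ioc_subset_Icc_self ht)
    have h2 := hasDerivAt_branchWeight (h1.2.trans_lt (hx.2.trans hb))
    refine HasDerivAt.const_mul _ (HasDerivAt.comp (h₂ := branchWeight) x h2 ?_)
    simpa using (hasDerivAt_id x).mul_const (1 - d + d * t)

theorem branchIntegral_le {d a : ℝ} (hd : d ∈ Icc (0 : ℝ) 1) (ha : a ∈ Ioo (0 : ℝ) (1 / 4)) :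
    branchIntegral d a ≤ branchWeight a := by
  have hsqrt : ContinuousOn (fun t : ℝ => √t) (uIcc 0 1) := by fun_prop
  have h := intervalIntegral.integral_mono_on (μ := volume) zero_le_one
    (hsqrt.mul (continuousOn_comp_mul_affine continuousOn_branchWeight ha hd)).intervalIntegrable
    (intervalIntegrable_const (c := branchWeight a)) fun t ht => by
      have h1 := mul_affine_mem_Icc ha.1.le hd ht
      exact (mul_le_of_le_one_left (branchWeight_nonneg _) (Real.sqrt_le_one.2 ht.2)).trans
        (monotoneOn_branchWeight (h1.2.trans_lt ha.2) ha.2 h1.2)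
  simpa [branchIntegral] using h

theorem branchIntegralDeriv_le {d a : ℝ} (hd : d ∈ Ioc (0 : ℝ) 1) (ha : a ∈ Ioo (0 : ℝ) (1 / 4)) :
    branchIntegralDeriv d a * (d * a) ≤ branchWeight a := by
  have hd' := Ioc_subset_Icc_self hd
  have hsqrt : ContinuousOn (fun t : ℝ => √t) (uIcc 0 1) := by fun_prop
  have hcont := continuousOn_comp_mul_affine continuousOn_branchWeightDeriv ha hd'
  have hle : branchIntegralDeriv d a ≤ ∫ t in (0 : ℝ)..1,
      branchWeightDeriv (a * (1 - d + d * t)) := by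
    refine intervalIntegral.integral_mono_on zero_le_one
      (hsqrt.mul (hcont.mul (by fun_prop))).intervalIntegrable hcont.intervalIntegrable
      fun t ht => ?_
    have h2 := mul_affine_mem_Icc zero_le_one hd' ht
    rw [one_mul] at h2
    have h3 := branchWeightDeriv_nonneg (a * (1 - d + d * t))
    exact (mul_le_of_le_one_left (mul_nonneg h3 h2.1) (Real.sqrt_le_one.2 ht.2)).trans
      (mul_le_of_le_one_right h3 h2.2)
  have hftc := intervalIntegral.integral_eq_sub_of_hasDerivAt (a := 0) (b := 1)
    (f := fun t => branchWeight (a * (1 - d + d * t)))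
    (f' := fun t => branchWeightDeriv (a * (1 - d + d * t)) * (d * a)) (fun t ht => by
      rw [uIcc_of_le zero_le_one] at ht
      have h1 := mul_affine_mem_Icc ha.1.le hd' ht
      refine HasDerivAt.comp (h₂ := branchWeight) t
        (hasDerivAt_branchWeight (h1.2.trans_lt ha.2)) ?_
      simpa [mul_comm] using (((hasDerivAt_id t).const_mul d).const_add (1 - d)).const_mul a)
    (hcont.mul continuousOn_const).intervalIntegrable
  rw [intervalIntegral.integral_mul_const] at hftc
  have hda : 0 ≤ d * a := mul_nonneg hd.1.le ha.1.le
  have h0 := branchWeight_nonneg (a * (1 - d + d * 0))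
  calc _ ≤ _ := mul_le_mul_of_nonneg_right hle hda
    _ = _ := hftc
    _ ≤ _ := by simpa using h0

theorem integral_eq_branchIntegral {c p : ℝ} (hc : c ∈ Icc (0 : ℝ) 1) (hp : p ∈ Ioo pstar 1) :
    ∫ u in p..pPlus ((c * √(A p)) ^ 2 - A p), √(((c * √(A p)) ^ 2 - A p) + A u) / u ^ 4 =
      c ^ 3 * (A p * √(A p)) * branchIntegral (c ^ 2) (A p) := by
  have ha := A_mem_Ioo hp
  have hpa := pPlus_neg_A hp
  set a := A p
  have hc0 := hc.1
  have hd : c ^ 2 ∈ Icc (0 : ℝ) 1 := ⟨sq_nonneg c, pow_le_one₀ hc.1 hc.2⟩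
  have hE : (c * √a) ^ 2 - a = -(a * (1 - c ^ 2)) := by
    rw [mul_pow, Real.sq_sqrt ha.1.le]
    ring
  have hlt : ∀ t ∈ uIcc (0 : ℝ) 1, a * (1 - c ^ 2 + c ^ 2 * t) < 1 / 4 := fun t ht =>
    (mul_affine_mem_Icc ha.1.le hd (by rwa [uIcc_of_le zero_le_one] at ht)).2.trans_lt ha.2
  have hderiv : ∀ t ∈ uIcc (0 : ℝ) 1, HasDerivAt (fun t => pPlus (-(a * (1 - c ^ 2 + c ^ 2 * t))))
      (-1 / (2 * pPlus (-(a * (1 - c ^ 2 + c ^ 2 * t))) *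
        √(1 + 4 * -(a * (1 - c ^ 2 + c ^ 2 * t)))) * (c ^ 2 * a)) t := fun t ht => by
    refine HasDerivAt.comp (h₂ := fun v => pPlus (-v)) t (hasDerivAt_pPlus_neg (hlt t ht)) ?_
    simpa [mul_comm] using
      (((hasDerivAt_id t).const_mul (c ^ 2)).const_add (1 - c ^ 2)).const_mul a
  have hpcont : ContinuousOn (fun t => pPlus (-(a * (1 - c ^ 2 + c ^ 2 * t)))) (uIcc 0 1) :=
    HasDerivAt.continuousOn hderiv
  have hsub := intervalIntegral.integral_comp_mul_deriv'
    (g := fun u => √(-(a * (1 - c ^ 2)) + A u) / u ^ 4) hderiv ?_ ?_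
  · simp only [mul_zero, mul_one, add_zero, sub_add_cancel, hpa, Function.comp_apply] at hsub
    rw [hE, intervalIntegral.integral_symm, ← hsub, branchIntegral,
      ← intervalIntegral.integral_const_mul, ← intervalIntegral.integral_neg]
    refine intervalIntegral.integral_congr fun t ht => ?_
    have hr : 0 < √(1 + 4 * -(a * (1 - c ^ 2 + c ^ 2 * t))) :=
      Real.sqrt_pos.2 (by linarith [hlt t ht])
    have hq := pPlus_pos (-(a * (1 - c ^ 2 + c ^ 2 * t)))
    have hs : √(-(a * (1 - c ^ 2)) + a * (1 - c ^ 2 + c ^ 2 * t)) = c * √a * √t := by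
      rw [show -(a * (1 - c ^ 2)) + a * (1 - c ^ 2 + c ^ 2 * t) = c ^ 2 * a * t by ring,
        Real.sqrt_mul (mul_nonneg (sq_nonneg c) ha.1.le), Real.sqrt_mul (sq_nonneg c),
        Real.sqrt_sq hc0]
    simp only [A_pPlus_neg (hlt t ht).le, hs, branchWeight]
    field_simp
  · refine (ContinuousOn.div continuousOn_const ((continuousOn_const.mul hpcont).mul
      (by fun_prop)) fun t ht => ne_of_gt ?_).mul continuousOn_const
    have hr : 0 < √(1 + 4 * -(a * (1 - c ^ 2 + c ^ 2 * t))) :=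
      Real.sqrt_pos.2 (by linarith [hlt t ht])
    have hq := pPlus_pos (-(a * (1 - c ^ 2 + c ^ 2 * t)))
    exact mul_pos (mul_pos two_pos hq) hr
  · refine ContinuousOn.div ?_ (by fun_prop) ?_
    · simp only [A]
      fun_prop
    · rintro _ ⟨t, -, rfl⟩
      exact ne_of_gt (pow_pos (pPlus_pos _) 4)

/-- `calF` divided by the positive factor `p³ √(A p)`, with `c = 1 / (2N)`. -/
noncomputable def normalizedF (c p : ℝ) : ℝ :=
  ((2 + c ^ 2) * p ^ 2 - (1 + c ^ 2)) / (p ^ 2 * √(1 - p ^ 2)) +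
    3 * c * (c ^ 3 * (A p * √(A p)) * branchIntegral (c ^ 2) (A p))

theorem calF_eq_mul_normalizedF {N : ℕ} (hN : 2 ≤ N) {p : ℝ} (hp : p ∈ Ioo pstar 1) :
    calF N p = p ^ 3 * √(A p) * normalizedF (1 / (2 * (N : ℝ))) p := by
  have hN' : (2 : ℝ) ≤ N := by exact_mod_cast hN
  have hc : 1 / (2 * (N : ℝ)) ∈ Icc (0 : ℝ) 1 :=
    ⟨by positivity, (div_le_one (by positivity)).2 (by linarith)⟩
  rw [calF, integral_eq_branchIntegral hc hp, normalizedF]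
  generalize 1 / (2 * (N : ℝ)) = c
  have h0 := (two_mul_sq_sub_one_pos hp).1
  have h2 : 0 < 1 - p ^ 2 := by nlinarith [hp.2]
  have hw := Real.sqrt_pos.2 h2
  have hA : √(A p) = p * √(1 - p ^ 2) := by
    rw [A, Real.sqrt_mul (sq_nonneg p), Real.sqrt_sq h0.le]
  have hw2 := Real.sq_sqrt h2.le
  generalize branchIntegral (c ^ 2) (A p) = J
  generalize A p * √(A p) = B
  rw [hA]
  field_simp
  rw [hw2]
  ring

theorem exists_hasDerivAt_normalizedF_pos {c p : ℝ} (hc : c ∈ Ioc (0 : ℝ) (1 / 4))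
    (hp : p ∈ Ioo pstar 1) : ∃ D, 0 < D ∧ HasDerivAt (normalizedF c) D p := by
  obtain ⟨h0, h1⟩ := two_mul_sq_sub_one_pos hp
  have h2 : 0 < 1 - p ^ 2 := by nlinarith [hp.2]
  have hw := Real.sqrt_pos.2 h2
  have hw2 := Real.sq_sqrt h2.le
  have ha := A_mem_Ioo hp
  have hc0 := hc.1
  have hd : c ^ 2 ∈ Ioc (0 : ℝ) 1 := ⟨by positivity, by nlinarith [hc.2]⟩
  have hA : √(A p) = p * √(1 - p ^ 2) := by
    rw [A, Real.sqrt_mul (sq_nonneg p), Real.sqrt_sq h0.le]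
  have hW : branchWeight (A p) = 1 / (2 * p ^ 5 * (2 * p ^ 2 - 1)) := by
    rw [branchWeight, pPlus_neg_A hp, sqrt_one_sub_four_mul_A hp]
  have hAderiv : HasDerivAt A (-(2 * p * (2 * p ^ 2 - 1))) p := by
    refine (((hasDerivAt_id p).pow 2).mul (((hasDerivAt_id p).pow 2).const_sub 1)).congr_deriv ?_
    simp
    ring
  have hsq : HasDerivAt (fun x => √(1 - x ^ 2)) (-p / √(1 - p ^ 2)) p := by
    refine ((((hasDerivAt_id p).pow 2).const_sub 1).sqrt h2.ne').congr_deriv ?_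
    simp
    field_simp
  have hrat : HasDerivAt
      (fun x => ((2 + c ^ 2) * x ^ 2 - (1 + c ^ 2)) / (x ^ 2 * √(1 - x ^ 2)))
      (2 * ((1 + c ^ 2 / 2) * p ^ 4 - 3 / 2 * (1 + c ^ 2) * p ^ 2 + (1 + c ^ 2)) /
        (p ^ 3 * √(1 - p ^ 2) ^ 3)) p := by
    refine ((((hasDerivAt_pow 2 p).const_mul (2 + c ^ 2)).sub_const (1 + c ^ 2)).div
      ((hasDerivAt_pow 2 p).mul hsq) (by simp only [Pi.mul_apply]; positivity)).congr_deriv ?_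
    simp only [Pi.mul_apply]
    field_simp
    rw [hw2]
    ring
  have hbr : ∀ a ∈ Ioo (0 : ℝ) (1 / 4), HasDerivAt (fun a => a * √a * branchIntegral (c ^ 2) a)
      (√a * (3 / 2 * branchIntegral (c ^ 2) a + a * branchIntegralDeriv (c ^ 2) a)) a := by
    intro a ha
    have hs := Real.sqrt_pos.2 ha.1
    refine (((hasDerivAt_id _).mul ((hasDerivAt_id _).sqrt ha.1.ne')).mul
      (hasDerivAt_branchIntegral (Ioc_subset_Icc_self hd) ha)).congr_deriv ?_
    simp only [id, Pi.mul_apply]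
    field_simp
    rw [Real.sq_sqrt ha.1.le]
    ring
  refine ⟨_, ?_, hrat.add ((((hbr _ ha).comp p hAderiv).const_mul (3 * c ^ 4)).congr_of_eventuallyEq
    (f₁ := fun x => 3 * c * (c ^ 3 * (A x * √(A x)) * branchIntegral (c ^ 2) (A x)))
    (Eventually.of_forall fun x => by simp only [Function.comp_apply]; ring))⟩
  have hJ := branchIntegral_le (Ioc_subset_Icc_self hd) ha
  have hJ' := branchIntegralDeriv_le hd ha
  rw [hW] at hJ hJ'
  have hX : c ^ 2 * (3 / 2 * branchIntegral (c ^ 2) (A p) +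
      A p * branchIntegralDeriv (c ^ 2) (A p)) ≤
      (1 + 3 / 2 * c ^ 2) * (1 / (2 * p ^ 5 * (2 * p ^ 2 - 1))) := by
    nlinarith [mul_le_mul_of_nonneg_left hJ hd.1.le]
  generalize 3 / 2 * branchIntegral (c ^ 2) (A p) +
      A p * branchIntegralDeriv (c ^ 2) (A p) = X at hX ⊢
  rw [hA]
  have hlow : 3 * c ^ 2 * (p * √(1 - p ^ 2) * (2 * p * (2 * p ^ 2 - 1))) * (c ^ 2 * X) ≤
      3 * c ^ 2 * (1 + 3 / 2 * c ^ 2) * √(1 - p ^ 2) ^ 4 / (p ^ 3 * √(1 - p ^ 2) ^ 3) := by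
    refine (mul_le_mul_of_nonneg_left hX (by positivity)).trans_eq ?_
    generalize 2 * p ^ 2 - 1 = m at h1
    field_simp
  have hpoly : 3 * c ^ 2 * (1 + 3 / 2 * c ^ 2) * (1 - p ^ 2) ^ 2 <
      2 * ((1 + c ^ 2 / 2) * p ^ 4 - 3 / 2 * (1 + c ^ 2) * p ^ 2 + (1 + c ^ 2)) := by
    have hc2 : c ^ 2 ≤ 1 / 16 := by nlinarith [hc.2]
    have e1 : (1 - p ^ 2) ^ 2 ≤ 1 / 4 := by nlinarith
    have e2 : c ^ 2 * (1 + 3 / 2 * c ^ 2) ≤ 1 / 8 := by nlinarith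
    have e3 := mul_le_mul e2 e1 (sq_nonneg _) (by norm_num)
    have e4 : 0 ≤ c ^ 2 * ((1 - p ^ 2) * (2 - p ^ 2)) :=
      mul_nonneg hd.1.le (mul_nonneg h2.le (by linarith))
    nlinarith [sq_nonneg (p ^ 2 - 3 / 4)]
  have hfrac : 3 * c ^ 2 * (1 + 3 / 2 * c ^ 2) * √(1 - p ^ 2) ^ 4 / (p ^ 3 * √(1 - p ^ 2) ^ 3) <
      2 * ((1 + c ^ 2 / 2) * p ^ 4 - 3 / 2 * (1 + c ^ 2) * p ^ 2 + (1 + c ^ 2)) /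
        (p ^ 3 * √(1 - p ^ 2) ^ 3) := by
    refine div_lt_div_of_pos_right ?_ (by positivity)
    rwa [show √(1 - p ^ 2) ^ 4 = (√(1 - p ^ 2) ^ 2) ^ 2 by ring, hw2]
  linarith

theorem strictMonoOn_normalizedF {c : ℝ} (hc : c ∈ Ioc (0 : ℝ) (1 / 4)) :
    StrictMonoOn (normalizedF c) (Ioo pstar 1) := by
  refine strictMonoOn_of_deriv_pos (convex_Ioo _ _) (fun p hp => ?_) fun p hp => ?_
  · obtain ⟨D, -, hD⟩ := exists_hasDerivAt_normalizedF_pos hc hp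
    exact hD.continuousAt.continuousWithinAt
  · obtain ⟨D, hpos, hD⟩ := exists_hasDerivAt_normalizedF_pos hc (interior_subset hp)
    rwa [hD.deriv]

/-- for `N ≥ 2`, at every zero `p₀ ∈ (p⋆, 1)` of `ℱ` one has `ℱ'(p₀) > 0`;
consequently `ℱ` has at most one zero in `(p⋆, 1)`. -/
theorem calF_deriv_pos_at_zeros (N : ℕ) (hN : 2 ≤ N) :
    (∀ p₀ ∈ Set.Ioo pstar 1, calF N p₀ = 0 → 0 < deriv (calF N) p₀) ∧
    (∀ p₁ ∈ Set.Ioo pstar 1, ∀ p₂ ∈ Set.Ioo pstar 1,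
      calF N p₁ = 0 → calF N p₂ = 0 → p₁ = p₂) := by
  have hN' : (2 : ℝ) ≤ N := by exact_mod_cast hN
  have hc : 1 / (2 * (N : ℝ)) ∈ Ioc (0 : ℝ) (1 / 4) :=
    ⟨by positivity, one_div_le_one_div_of_le (by norm_num) (by linarith)⟩
  have hM : ∀ p ∈ Ioo pstar 1, 0 < p ^ 3 * √(A p) := fun p hp =>
    mul_pos (pow_pos (two_mul_sq_sub_one_pos hp).1 3) (Real.sqrt_pos.2 (A_mem_Ioo hp).1)
  have hzero : ∀ p ∈ Ioo pstar 1, calF N p = 0 → normalizedF (1 / (2 * (N : ℝ))) p = 0 :=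
    fun p hp h => by
      rw [calF_eq_mul_normalizedF hN hp] at h
      exact (mul_eq_zero.1 h).resolve_left (hM p hp).ne'
  refine ⟨fun p hp h => ?_, fun p₁ h₁ p₂ h₂ hz₁ hz₂ => ?_⟩
  · obtain ⟨D, hpos, hD⟩ := exists_hasDerivAt_normalizedF_pos hc hp
    have hdiff : DifferentiableAt ℝ (fun x => x ^ 3 * √(A x)) p := by
      have hA : DifferentiableAt ℝ A p := by unfold A; fun_prop
      exact (differentiableAt_pow 3).mul (hA.sqrt (A_mem_Ioo hp).1.ne')
    have heq : calF N =ᶠ[𝓝 p] (fun x => x ^ 3 * √(A x)) * normalizedF (1 / (2 * (N : ℝ))) := by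
      filter_upwards [Ioo_mem_nhds hp.1 hp.2] with x hx using calF_eq_mul_normalizedF hN hx
    rw [heq.deriv_eq, (hdiff.hasDerivAt.mul hD).deriv, hzero p hp h, mul_zero, zero_add]
    exact mul_pos (hM p hp) hpos
  · exact (strictMonoOn_normalizedF hc).injOn h₁ h₂
      ((hzero p₁ h₁ hz₁).trans (hzero p₂ h₂ hz₂).symm)
end

section
/- For every fixed p₀ ∈ (0, p_*), the function q₀ ↦ T₋(p₀, q₀) is strictly increasing on (0, √A(p₀)) (its partial derivative ∂T₋/∂q₀(p₀,q₀) is positive there); moreover T₋(p₀, q₀) → 0 as q₀ → 0⁺ and T₋(p₀, q₀) → ∞ as q₀ → √A(p₀)⁻. -/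
open Real MeasureTheory Set Filter Topology

/-- The value of `1/2 - u²` at the point of the orbit where `√(E + A u) = q s`, with
`a = 1/2 - p₀²`. -/
noncomputable def orbitHeight (a q s : ℝ) : ℝ := Real.sqrt (a ^ 2 + q ^ 2 * (1 - s ^ 2))

/-- The regular integrand of `T₋` after the substitution `√(E + A u) = q s`, `s ∈ [0, 1]`. -/
noncomputable def periodKernel (a q s : ℝ) : ℝ :=
  q / (2 * orbitHeight a q s * Real.sqrt (1 / 2 - orbitHeight a q s))

/-- The partial derivative of `periodKernel a q s` in `q`. -/
noncomputable def periodKernelDeriv (a q s : ℝ) : ℝ :=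
  a ^ 2 / (2 * orbitHeight a q s ^ 3 * Real.sqrt (1 / 2 - orbitHeight a q s)) +
    q ^ 2 * (1 - s ^ 2) / (4 * orbitHeight a q s ^ 2 * (1 / 2 - orbitHeight a q s) *
      Real.sqrt (1 / 2 - orbitHeight a q s))

section

variable {a q s : ℝ}

lemma orbitHeight_radicand_pos (ha : 0 < a) (hs : s ∈ Icc (0 : ℝ) 1) :
    0 < a ^ 2 + q ^ 2 * (1 - s ^ 2) := by
  have : 0 ≤ 1 - s ^ 2 := by nlinarith [hs.1, hs.2]
  positivity

lemma orbitHeight_pos (ha : 0 < a) (hs : s ∈ Icc (0 : ℝ) 1) : 0 < orbitHeight a q s :=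
  Real.sqrt_pos.2 (orbitHeight_radicand_pos ha hs)

lemma orbitHeight_sq (ha : 0 < a) (hs : s ∈ Icc (0 : ℝ) 1) :
    orbitHeight a q s ^ 2 = a ^ 2 + q ^ 2 * (1 - s ^ 2) :=
  Real.sq_sqrt (orbitHeight_radicand_pos ha hs).le

lemma orbitHeight_lt_half (hq : a ^ 2 + q ^ 2 < 1 / 4) : orbitHeight a q s < 1 / 2 := by
  rw [orbitHeight, Real.sqrt_lt' (by norm_num)]
  nlinarith [mul_nonneg (sq_nonneg q) (sq_nonneg s)]

lemma sqrt_half_sub_orbitHeight_pos (hq : a ^ 2 + q ^ 2 < 1 / 4) :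
    0 < Real.sqrt (1 / 2 - orbitHeight a q s) :=
  Real.sqrt_pos.2 (by linarith [orbitHeight_lt_half (s := s) hq])

@[fun_prop]
lemma continuous_orbitHeight : Continuous fun x : ℝ × ℝ => orbitHeight a x.1 x.2 := by
  unfold orbitHeight
  fun_prop

lemma hasDerivAt_orbitHeight_left (ha : 0 < a) (hs : s ∈ Icc (0 : ℝ) 1) :
    HasDerivAt (fun q => orbitHeight a q s) (q * (1 - s ^ 2) / orbitHeight a q s) q := by
  have h := (((hasDerivAt_pow 2 q).mul_const (1 - s ^ 2)).const_add (a ^ 2)).sqrt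
    (orbitHeight_radicand_pos ha hs).ne'
  refine h.congr_deriv ?_
  have := (orbitHeight_pos (q := q) ha hs).ne'
  unfold orbitHeight at *
  field_simp
  simp only [Nat.cast_ofNat, Nat.add_one_sub_one, pow_one]
  ring

lemma hasDerivAt_orbitHeight_right (ha : 0 < a) (hs : s ∈ Icc (0 : ℝ) 1) :
    HasDerivAt (fun s => orbitHeight a q s) (-(q ^ 2 * s) / orbitHeight a q s) s := by
  have h := ((((hasDerivAt_pow 2 s).const_sub 1).const_mul (q ^ 2)).const_add (a ^ 2)).sqrt
    (orbitHeight_radicand_pos ha hs).ne'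
  refine h.congr_deriv ?_
  have := (orbitHeight_pos (q := q) ha hs).ne'
  unfold orbitHeight at *
  field_simp
  simp

lemma hasDerivAt_periodKernel (ha : 0 < a) (hq : a ^ 2 + q ^ 2 < 1 / 4)
    (hs : s ∈ Icc (0 : ℝ) 1) :
    HasDerivAt (fun q => periodKernel a q s) (periodKernelDeriv a q s) q := by
  have hW := orbitHeight_pos (q := q) ha hs
  have hV := sqrt_half_sub_orbitHeight_pos (s := s) hq
  have hW' := orbitHeight_lt_half (s := s) hq
  have hd := hasDerivAt_orbitHeight_left (q := q) ha hs
  have h := (hasDerivAt_id q).div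
    ((hd.const_mul 2).mul ((hd.const_sub (1 / 2)).sqrt (by linarith)))
    (by simp only [Pi.mul_apply]; positivity)
  refine h.congr_deriv ?_
  have hsq := orbitHeight_sq (q := q) ha hs
  have hvsq : Real.sqrt (1 / 2 - orbitHeight a q s) ^ 2 = 1 / 2 - orbitHeight a q s :=
    Real.sq_sqrt (by linarith)
  simp only [Pi.mul_apply, id, periodKernelDeriv]
  generalize Real.sqrt (1 / 2 - orbitHeight a q s) = v at *
  generalize orbitHeight a q s = w at *
  have ha2 : a ^ 2 = w ^ 2 - q ^ 2 * (1 - s ^ 2) := by linarith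
  rw [← hvsq, ha2]
  field_simp
  ring

lemma periodKernelDeriv_pos (ha : 0 < a) (hq : a ^ 2 + q ^ 2 < 1 / 4)
    (hs : s ∈ Icc (0 : ℝ) 1) : 0 < periodKernelDeriv a q s := by
  have hW := orbitHeight_pos (q := q) ha hs
  have hV := sqrt_half_sub_orbitHeight_pos (s := s) hq
  have hW' : 0 < 1 / 2 - orbitHeight a q s := by linarith [orbitHeight_lt_half (s := s) hq]
  have hs' : 0 ≤ 1 - s ^ 2 := by nlinarith [hs.1, hs.2]
  unfold periodKernelDeriv
  positivity

lemma continuousOn_periodKernel (ha : 0 < a) (hq : a ^ 2 + q ^ 2 < 1 / 4) :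
    ContinuousOn (periodKernel a q) (Icc 0 1) := by
  have hc : Continuous (orbitHeight a q) := by unfold orbitHeight; fun_prop
  unfold periodKernel
  refine ContinuousOn.div (by fun_prop) (by fun_prop) fun s hs => ?_
  have hW := orbitHeight_pos (q := q) ha hs
  have hV := sqrt_half_sub_orbitHeight_pos (s := s) hq
  positivity

lemma continuousOn_periodKernelDeriv {r : ℝ} (ha : 0 < a) (hr : a ^ 2 + r ^ 2 < 1 / 4) :
    ContinuousOn (fun x : ℝ × ℝ => periodKernelDeriv a x.1 x.2) (Icc (-r) r ×ˢ Icc 0 1) := by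
  unfold periodKernelDeriv
  refine ContinuousOn.add (ContinuousOn.div (by fun_prop) (by fun_prop) ?_)
    (ContinuousOn.div (by fun_prop) (by fun_prop) ?_) <;>
  · rintro ⟨x, s⟩ ⟨hx, hs⟩
    have hx' : a ^ 2 + x ^ 2 < 1 / 4 := by nlinarith [hx.1, hx.2]
    have hW := orbitHeight_pos (q := x) ha hs
    have hV := sqrt_half_sub_orbitHeight_pos (s := s) hx'
    have hW' : 0 < 1 / 2 - orbitHeight a x s := by linarith [orbitHeight_lt_half (s := s) hx']
    simp only
    positivity

lemma intervalIntegrable_periodKernel (ha : 0 < a) (hq : a ^ 2 + q ^ 2 < 1 / 4) :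
    IntervalIntegrable (periodKernel a q) volume 0 1 :=
  ContinuousOn.intervalIntegrable_of_Icc zero_le_one (continuousOn_periodKernel ha hq)

lemma hasDerivAt_integral_periodKernel (ha : 0 < a) (hq : a ^ 2 + q ^ 2 < 1 / 4) :
    IntervalIntegrable (periodKernelDeriv a q) volume 0 1 ∧
      HasDerivAt (fun q => ∫ s in (0 : ℝ)..1, periodKernel a q s)
        (∫ s in (0 : ℝ)..1, periodKernelDeriv a q s) q := by
  obtain ⟨r, hqr, hr⟩ : ∃ r, |q| < r ∧ a ^ 2 + r ^ 2 < 1 / 4 := by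
    obtain ⟨r, h₁, h₂⟩ := exists_between
      (show |q| < Real.sqrt (1 / 4 - a ^ 2) from Real.lt_sqrt_of_sq_lt (by rw [sq_abs]; linarith))
    have := (Real.lt_sqrt ((abs_nonneg q).trans h₁.le)).1 h₂
    exact ⟨r, h₁, by linarith⟩
  have hmem : Icc (-r) r ∈ 𝓝 q := Icc_mem_nhds (abs_lt.1 hqr).1 (abs_lt.1 hqr).2
  have hlt : ∀ x ∈ Icc (-r) r, a ^ 2 + x ^ 2 < 1 / 4 := fun x hx => by nlinarith [hx.1, hx.2]
  have hcont := continuousOn_periodKernelDeriv ha hr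
  obtain ⟨C, hC⟩ := (isCompact_Icc.prod isCompact_Icc).exists_bound_of_continuousOn hcont
  have hsub : uIoc (0 : ℝ) 1 ⊆ Icc 0 1 := by
    rw [uIoc_of_le zero_le_one]; exact Ioc_subset_Icc_self
  have hslice : ContinuousOn (periodKernelDeriv a q) (Icc 0 1) :=
    hcont.comp (f := fun s => (q, s)) (by fun_prop) fun s hs => ⟨mem_of_mem_nhds hmem, hs⟩
  refine intervalIntegral.hasDerivAt_integral_of_dominated_loc_of_deriv_le (bound := fun _ => C)
    hmem ?_ (intervalIntegrable_periodKernel ha hq) ?_ ?_ intervalIntegrable_const ?_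
  · filter_upwards [hmem] with x hx
    exact ((continuousOn_periodKernel ha (hlt x hx)).mono hsub).aestronglyMeasurable
      measurableSet_uIoc
  · exact (hslice.mono hsub).aestronglyMeasurable measurableSet_uIoc
  · exact .of_forall fun s hs x hx => hC (x, s) ⟨hx, hsub hs⟩
  · exact .of_forall fun s hs x hx => hasDerivAt_periodKernel ha (hlt x hx) (hsub hs)

lemma integral_periodKernelDeriv_pos (ha : 0 < a) (hq : a ^ 2 + q ^ 2 < 1 / 4) :
    0 < ∫ s in (0 : ℝ)..1, periodKernelDeriv a q s :=
  intervalIntegral.intervalIntegral_pos_of_pos_on (hasDerivAt_integral_periodKernel ha hq).1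
    (fun _ hs => periodKernelDeriv_pos ha hq (Ioo_subset_Icc_self hs)) zero_lt_one

/-- As `(a, q)` approaches the separatrix `a² + q² = 1/4`, the kernel dominates a function
with logarithmically diverging integral. -/
lemma le_periodKernel {e : ℝ} (ha : 0 < a) (hq₀ : 0 < q) (he : 0 < e)
    (heq : a ^ 2 + q ^ 2 + e ^ 2 = 1 / 4) (hs : s ∈ Icc (0 : ℝ) 1) :
    1 / Real.sqrt 2 * (q / (e + q * s)) ≤ periodKernel a q s := by
  have hq : a ^ 2 + q ^ 2 < 1 / 4 := by nlinarith
  have hW := orbitHeight_pos (q := q) ha hs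
  have hV := sqrt_half_sub_orbitHeight_pos (s := s) hq
  have hW' := orbitHeight_lt_half (s := s) hq
  have hsq := orbitHeight_sq (q := q) ha hs
  have hqs : 0 ≤ q * s := mul_nonneg hq₀.le hs.1
  have hv : Real.sqrt (1 / 2 - orbitHeight a q s) ≤ Real.sqrt 2 * (e + q * s) := by
    refine Real.sqrt_le_iff.2 ⟨by positivity, ?_⟩
    rw [mul_pow, Real.sq_sqrt zero_le_two]
    nlinarith
  rw [one_div_mul_eq_div, div_div, periodKernel]
  refine div_le_div_of_nonneg_left hq₀.le (by positivity) ?_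
  nlinarith

lemma integral_div_add_mul {e : ℝ} (hq : 0 < q) (he : 0 < e) :
    IntervalIntegrable (fun s => q / (e + q * s)) volume 0 1 ∧
      ∫ s in (0 : ℝ)..1, q / (e + q * s) = Real.log (1 + q / e) := by
  have hpos : ∀ s ∈ uIcc (0 : ℝ) 1, 0 < e + q * s := fun s hs => by
    rw [uIcc_of_le zero_le_one] at hs
    have := mul_nonneg hq.le hs.1
    linarith
  have hint : IntervalIntegrable (fun s => q / (e + q * s)) volume 0 1 :=
    ContinuousOn.intervalIntegrable
      (ContinuousOn.div (by fun_prop) (by fun_prop) fun s hs => (hpos s hs).ne')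
  refine ⟨hint, ?_⟩
  rw [intervalIntegral.integral_eq_sub_of_hasDerivAt (f := fun s => Real.log (e + q * s))
    (fun s hs => ?_) hint]
  · rw [← Real.log_div (hpos 1 (by simp)).ne' (hpos 0 (by simp)).ne']
    congr 1
    field_simp
    ring
  · simpa using (((hasDerivAt_id s).const_mul q).const_add e).log (hpos s hs).ne'

lemma log_le_integral_periodKernel {e : ℝ} (ha : 0 < a) (hq₀ : 0 < q) (he : 0 < e)
    (heq : a ^ 2 + q ^ 2 + e ^ 2 = 1 / 4) :
    1 / Real.sqrt 2 * Real.log (1 + q / e) ≤ ∫ s in (0 : ℝ)..1, periodKernel a q s := by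
  obtain ⟨hint, hval⟩ := integral_div_add_mul hq₀ he
  rw [← hval, ← intervalIntegral.integral_const_mul]
  exact intervalIntegral.integral_mono_on zero_le_one (hint.const_mul _)
    (intervalIntegrable_periodKernel ha (by nlinarith))
    fun s hs => le_periodKernel ha hq₀ he heq hs

end

lemma A_eq_quarter_sub_sq (u : ℝ) : A u = 1 / 4 - (1 / 2 - u ^ 2) ^ 2 := by
  unfold A; ring

lemma half_sub_sq_pos_of_mem {p₀ : ℝ} (hp₀ : p₀ ∈ Ioo 0 pstar) : 0 < 1 / 2 - p₀ ^ 2 := by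
  have h := pow_lt_pow_left₀ hp₀.2 hp₀.1.le two_ne_zero
  rw [pstar, div_pow, Real.sq_sqrt zero_le_two] at h
  linarith

lemma Tminus_eq_integral_periodKernel {p₀ q : ℝ} (hp₀ : p₀ ∈ Ioo 0 pstar) (hq₀ : 0 < q)
    (hq : (1 / 2 - p₀ ^ 2) ^ 2 + q ^ 2 < 1 / 4) :
    Tminus p₀ q = ∫ s in (0 : ℝ)..1, periodKernel (1 / 2 - p₀ ^ 2) q s := by
  have ha := half_sub_sq_pos_of_mem hp₀
  have hE := A_eq_quarter_sub_sq p₀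
  generalize haw : 1 / 2 - p₀ ^ 2 = a at *
  let f : ℝ → ℝ := fun s => Real.sqrt (1 / 2 - orbitHeight a q s)
  have hf0 : f 0 = pMinus (q ^ 2 - A p₀) := by
    have h : Real.sqrt (1 + 4 * (q ^ 2 - A p₀)) = 2 * orbitHeight a q 0 := by
      have h₀ := orbitHeight_pos (q := q) ha (s := 0) (by simp)
      have h₁ := orbitHeight_sq (q := q) ha (s := 0) (by simp)
      rw [Real.sqrt_eq_iff_mul_self_eq_of_pos (by positivity), hE]
      linarith
    simp only [f, pMinus, h]
    congr 1
    ring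
  have hf1 : f 1 = p₀ := by
    have h : orbitHeight a q 1 = a := by simp [orbitHeight, Real.sqrt_sq ha.le]
    simp only [f, h]
    rw [← haw, sub_sub_cancel, Real.sqrt_sq hp₀.1.le]
  have hd : ∀ s ∈ Ioo (0 : ℝ) 1,
      HasDerivAt f (q ^ 2 * s / (2 * orbitHeight a q s * f s)) s := fun s hs => by
    have hs' := Ioo_subset_Icc_self hs
    have hW := orbitHeight_pos (q := q) ha hs'
    have hV := sqrt_half_sub_orbitHeight_pos (s := s) hq
    refine (((hasDerivAt_orbitHeight_right (q := q) ha hs').const_sub (1 / 2)).sqrt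
      (Real.sqrt_pos.1 hV).ne').congr_deriv ?_
    simp only [f]
    field_simp
  have hsubst := intervalIntegral.integral_deriv_smul_comp_of_deriv_nonneg (a := 0) (b := 1)
    (f := f) (f' := fun s => q ^ 2 * s / (2 * orbitHeight a q s * f s))
    (g := fun u => 1 / Real.sqrt ((q ^ 2 - A p₀) + A u))
    (by simp only [f, orbitHeight]; fun_prop) (by simpa using hd)
    (by
      simp only [zero_le_one, inf_of_le_left, sup_of_le_right]
      intro s hs
      have hs₀ := hs.1
      have hW := orbitHeight_pos (q := q) ha (Ioo_subset_Icc_self hs)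
      have hV := sqrt_half_sub_orbitHeight_pos (s := s) hq
      simp only [f]
      positivity)
  rw [hf0, hf1] at hsubst
  rw [Tminus, ← hsubst]
  refine intervalIntegral.integral_congr_Ioo_of_le zero_le_one fun s hs => ?_
  have hs₀ := hs.1
  have hs' := Ioo_subset_Icc_self hs
  have hW := orbitHeight_pos (q := q) ha hs'
  have hV := sqrt_half_sub_orbitHeight_pos (s := s) hq
  have hroot : Real.sqrt (q ^ 2 - A p₀ + A (f s)) = q * s := by
    rw [A_eq_quarter_sub_sq (f s), Real.sq_sqrt (Real.sqrt_pos.1 hV).le, sub_sub_cancel,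
      orbitHeight_sq ha hs', hE, ← Real.sqrt_sq (mul_nonneg hq₀.le hs₀.le)]
    congr 1
    ring
  simp only [Function.comp_apply, hroot, smul_eq_mul, periodKernel]
  simp only [f]
  field_simp

/-- for every fixed `p₀ ∈ (0, p⋆)`, `q₀ ↦ T₋(p₀,q₀)` is strictly increasing on
`(0, √A(p₀))` with positive partial derivative there; moreover `T₋(p₀,q₀) → 0` as `q₀ → 0⁺`
and `T₋(p₀,q₀) → ∞` as `q₀ → √A(p₀)⁻`. -/
theorem Tminus_strictly_increasing (p₀ : ℝ) (hp₀ : p₀ ∈ Set.Ioo 0 pstar) :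
    StrictMonoOn (fun q₀ => Tminus p₀ q₀) (Set.Ioo 0 (Real.sqrt (A p₀))) ∧
    (∀ q₀ ∈ Set.Ioo (0 : ℝ) (Real.sqrt (A p₀)), 0 < deriv (fun q => Tminus p₀ q) q₀) ∧
    Tendsto (fun q₀ => Tminus p₀ q₀) (nhdsWithin 0 (Set.Ioi 0)) (nhds 0) ∧
    Tendsto (fun q₀ => Tminus p₀ q₀)
      (nhdsWithin (Real.sqrt (A p₀)) (Set.Iio (Real.sqrt (A p₀)))) atTop := by
  have ha := half_sub_sq_pos_of_mem hp₀
  have hA := A_eq_quarter_sub_sq p₀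
  have hT : ∀ q ∈ Ioo (0 : ℝ) (Real.sqrt (A p₀)), 0 < q ∧
      (1 / 2 - p₀ ^ 2) ^ 2 + q ^ 2 < 1 / 4 ∧
      Tminus p₀ q = ∫ s in (0 : ℝ)..1, periodKernel (1 / 2 - p₀ ^ 2) q s := fun q hq => by
    have hq' : (1 / 2 - p₀ ^ 2) ^ 2 + q ^ 2 < 1 / 4 := by
      linarith [(Real.lt_sqrt hq.1.le).1 hq.2]
    exact ⟨hq.1, hq', Tminus_eq_integral_periodKernel hp₀ hq.1 hq'⟩
  have hApos : 0 < A p₀ := by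
    rw [hA]; nlinarith [hp₀.1, pow_pos hp₀.1 2]
  have hQ : 0 < Real.sqrt (A p₀) := Real.sqrt_pos.2 hApos
  generalize 1 / 2 - p₀ ^ 2 = a at *
  have hderiv : ∀ q ∈ Ioo (0 : ℝ) (Real.sqrt (A p₀)),
      HasDerivAt (fun q => Tminus p₀ q) (∫ s in (0 : ℝ)..1, periodKernelDeriv a q s) q := by
    intro q hq
    refine (hasDerivAt_integral_periodKernel ha (hT q hq).2.1).2.congr_of_eventuallyEq ?_
    filter_upwards [Ioo_mem_nhds hq.1 hq.2] with x hx using (hT x hx).2.2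
  have hpos : ∀ q ∈ Ioo (0 : ℝ) (Real.sqrt (A p₀)), 0 < deriv (fun q => Tminus p₀ q) q :=
    fun q hq => by
      rw [(hderiv q hq).deriv]
      exact integral_periodKernelDeriv_pos ha (hT q hq).2.1
  refine ⟨strictMonoOn_of_deriv_pos (convex_Ioo _ _)
    (fun q hq => (hderiv q hq).continuousAt.continuousWithinAt)
    (by rwa [interior_Ioo]), hpos, ?_, ?_⟩
  · have h₀ := (hasDerivAt_integral_periodKernel (q := 0) ha (by linarith)).2.continuousAt.tendsto
    simp only [periodKernel, zero_div, intervalIntegral.integral_zero] at h₀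
    refine (h₀.mono_left nhdsWithin_le_nhds).congr' ?_
    filter_upwards [Ioo_mem_nhdsGT hQ] with q hq using (hT q hq).2.2.symm
  · let e : ℝ → ℝ := fun q => Real.sqrt (A p₀ - q ^ 2)
    have he_pos : ∀ q ∈ Ioo (0 : ℝ) (Real.sqrt (A p₀)), 0 < e q := fun q hq =>
      Real.sqrt_pos.2 (sub_pos.2 ((Real.lt_sqrt hq.1.le).1 hq.2))
    have hmem := Ioo_mem_nhdsLT hQ
    have he : Tendsto e (𝓝[<] Real.sqrt (A p₀)) (𝓝[>] 0) := by
      refine tendsto_nhdsWithin_iff.2 ⟨?_, by filter_upwards [hmem] with q hq using he_pos q hq⟩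
      have hc : Continuous e := by fun_prop
      have h := hc.tendsto (Real.sqrt (A p₀))
      simp only [e, Real.sq_sqrt hApos.le, sub_self, Real.sqrt_zero] at h
      exact h.mono_left nhdsWithin_le_nhds
    have hdiv : Tendsto (fun q => q / e q) (𝓝[<] Real.sqrt (A p₀)) atTop :=
      (tendsto_nhdsWithin_of_tendsto_nhds tendsto_id).pos_mul_atTop hQ he.inv_tendsto_nhdsGT_zero
    have hlog : Tendsto (fun q => 1 / Real.sqrt 2 * Real.log (1 + q / e q))
        (𝓝[<] Real.sqrt (A p₀)) atTop :=
      (Real.tendsto_log_atTop.comp (tendsto_atTop_add_const_left _ 1 hdiv)).const_mul_atTop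
        (by positivity)
    refine tendsto_atTop_mono' _ ?_ hlog
    filter_upwards [hmem] with q hq
    rw [(hT q hq).2.2]
    refine log_le_integral_periodKernel ha hq.1 (he_pos q hq) ?_
    rw [Real.sq_sqrt (Real.sqrt_pos.1 (he_pos q hq)).le, hA]
    ring
end

section
/- Fix integers N ≥ 2 and 1 ≤ K ≤ N − 1. For every p₀ ∈ (0, p_*) there exists exactly one pair (q₁, q_N) with q₁ > 0 and q_N ∈ (0, √A(p₀)) solving the system T₊(p₀, q₁) = T₋(p₀, q_N) and 2K q₁ − 2(N − K) q_N = √A(p₀); moreover q₁ lies in the interval [ (1/(2K))√A(p₀), ((2(N−K)+1)/(2K))√A(p₀) ]. -/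
open Real MeasureTheory Set Filter Topology

/-- Along an orbit of radius `r = √(1 + 4E)`, the value of `u` at angle `φ`, measured from the
bottom turning point (`φ = 0`) to the top turning point (`φ = π`). -/
noncomputable def orbit (r φ : ℝ) : ℝ := Real.sqrt ((1 - r * Real.cos φ) / 2)

/-- The part of the half-period below `√((1 - c) / 2)`, in the angle variable. -/
noncomputable def lowerTime (c r : ℝ) : ℝ :=
  ∫ φ in 0..Real.arccos (c / r), 1 / (2 * orbit r φ)

/-- The part of the half-period above `√((1 - c) / 2)`, in the angle variable. -/
noncomputable def upperTime (c r : ℝ) : ℝ :=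
  ∫ φ in Real.arccos (c / r)..π, 1 / (2 * orbit r φ)

lemma orbit_pos {r φ : ℝ} (h : 0 < 1 - r * Real.cos φ) : 0 < orbit r φ :=
  Real.sqrt_pos.2 (by linarith)

lemma energy_add_A_orbit {r φ : ℝ} (h : 0 ≤ 1 - r * Real.cos φ) :
    (r ^ 2 - 1) / 4 + A (orbit r φ) = (r * Real.sin φ / 2) ^ 2 := by
  have h2 : orbit r φ ^ 2 = (1 - r * Real.cos φ) / 2 := Real.sq_sqrt (by linarith)
  rw [A, h2]
  linear_combination (-(r ^ 2) / 4) * Real.sin_sq_add_cos_sq φ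

lemma hasDerivAt_orbit {r φ : ℝ} (h : 0 < 1 - r * Real.cos φ) :
    HasDerivAt (orbit r) (r * Real.sin φ / 2 / (2 * orbit r φ)) φ := by
  have h1 : HasDerivAt (fun φ => (1 - r * Real.cos φ) / 2) (r * Real.sin φ / 2) φ :=
    ((((Real.hasDerivAt_cos φ).const_mul r).const_sub 1).div_const 2).congr_deriv (by ring)
  exact h1.sqrt (by linarith)

lemma cos_le_cos_of_mem {α φ : ℝ} (hα : 0 ≤ α) (hφ : φ ∈ Icc α π) :
    Real.cos φ ≤ Real.cos α :=
  Real.cos_le_cos_of_nonneg_of_le_pi hα hφ.2 hφ.1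

lemma one_sub_pos_of_mem {r α φ : ℝ} (hr : 0 < r) (hα : 0 ≤ α)
    (hpos : 0 < 1 - r * Real.cos α) (hφ : φ ∈ Icc α π) : 0 < 1 - r * Real.cos φ := by
  have := mul_le_mul_of_nonneg_left (cos_le_cos_of_mem hα hφ) hr.le
  linarith

lemma continuous_orbit : Continuous (Function.uncurry orbit) := by
  unfold orbit Function.uncurry
  fun_prop

lemma continuousOn_integrand {r α : ℝ} (hr : 0 < r) (hα : 0 ≤ α)
    (hpos : 0 < 1 - r * Real.cos α) :
    ContinuousOn (fun φ => 1 / (2 * orbit r φ)) (Icc α π) := by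
  have h : Continuous (orbit r) := continuous_orbit.comp (by fun_prop : Continuous fun φ => (r, φ))
  refine continuousOn_const.div (continuousOn_const.mul h.continuousOn) fun φ hφ => ?_
  have := orbit_pos (one_sub_pos_of_mem hr hα hpos hφ)
  positivity

lemma intervalIntegrable_integrand {r α β γ : ℝ} (hr : 0 < r) (hα : 0 ≤ α)
    (hpos : 0 < 1 - r * Real.cos α) (hβ : β ∈ Icc α π) (hγ : γ ∈ Icc α π) :
    IntervalIntegrable (fun φ => 1 / (2 * orbit r φ)) volume β γ :=
  ((continuousOn_integrand hr hα hpos).mono (ordConnected_Icc.uIcc_subset hβ hγ)).intervalIntegrable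

/-- The period integral in the angle variable. -/
lemma integral_orbit {r α β : ℝ} (hr : 0 < r) (hα : 0 ≤ α) (hαβ : α ≤ β) (hβ : β ≤ π)
    (hpos : 0 < 1 - r * Real.cos α) :
    ∫ u in orbit r α..orbit r β, 1 / Real.sqrt ((r ^ 2 - 1) / 4 + A u) =
      ∫ φ in α..β, 1 / (2 * orbit r φ) := by
  have h1 : ∀ φ ∈ Icc α β, 0 < 1 - r * Real.cos φ := fun φ hφ =>
    one_sub_pos_of_mem hr hα hpos ⟨hφ.1, hφ.2.trans hβ⟩
  have hsin : ∀ φ ∈ Ioo α β, 0 < Real.sin φ := fun φ hφ =>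
    Real.sin_pos_of_pos_of_lt_pi (hα.trans_lt hφ.1) (hφ.2.trans_le hβ)
  rw [← intervalIntegral.integral_comp_mul_deriv_of_deriv_nonneg
    (f' := fun φ => r * Real.sin φ / 2 / (2 * orbit r φ))]
  · rw [intervalIntegral.integral_of_le hαβ, intervalIntegral.integral_of_le hαβ,
      integral_Ioc_eq_integral_Ioo, integral_Ioc_eq_integral_Ioo]
    refine setIntegral_congr_fun measurableSet_Ioo fun φ hφ => ?_
    have hp := h1 φ (Ioo_subset_Icc_self hφ)
    have hs := hsin φ hφ
    have ho := orbit_pos hp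
    simp only [Function.comp_apply]
    rw [energy_add_A_orbit hp.le, Real.sqrt_sq (by positivity)]
    field_simp
  · exact (continuous_orbit.comp (by fun_prop : Continuous fun φ => (r, φ))).continuousOn
  · rw [min_eq_left hαβ, max_eq_right hαβ]
    exact fun φ hφ => hasDerivAt_orbit (h1 φ (Ioo_subset_Icc_self hφ))
  · rw [min_eq_left hαβ, max_eq_right hαβ]
    intro φ hφ
    have := hsin φ hφ
    have := orbit_pos (h1 φ (Ioo_subset_Icc_self hφ))
    positivity

section Angle

variable {c r : ℝ}

lemma mul_cos_arccos_div (hc : 0 < c) (hr : c ≤ r) : r * Real.cos (Real.arccos (c / r)) = c := by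
  have hr0 : 0 < r := hc.trans_le hr
  have h0 : 0 ≤ c / r := by positivity
  rw [Real.cos_arccos (by linarith) ((div_le_one hr0).2 hr)]
  field_simp

lemma arccos_div_le_pi_div_two (hc : 0 < c) (hr : c ≤ r) : Real.arccos (c / r) ≤ π / 2 :=
  Real.arccos_le_pi_div_two.2 (div_nonneg hc.le (hc.trans_le hr).le)

lemma one_sub_mul_cos_arccos_pos (hc : 0 < c) (hc1 : c < 1) (hr : c ≤ r) :
    0 < 1 - r * Real.cos (Real.arccos (c / r)) := by
  rw [mul_cos_arccos_div hc hr]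
  linarith

lemma arccos_div_lt {r' : ℝ} (hc : 0 < c) (hr : c ≤ r) (hrr' : r < r') :
    Real.arccos (c / r) < Real.arccos (c / r') := by
  have hr0 : 0 < r := hc.trans_le hr
  have hr0' : 0 < r' := hr0.trans hrr'
  have h0 : 0 < c / r := by positivity
  have h0' : 0 < c / r' := by positivity
  have hlt : c / r' < c / r := div_lt_div_of_pos_left hc hr0 hrr'
  have h1 : c / r ≤ 1 := (div_le_one hr0).2 hr
  exact Real.strictAntiOn_arccos ⟨by linarith, by linarith⟩ ⟨by linarith, h1⟩ hlt

end Angle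

lemma one_sub_mul_cos_pos {r : ℝ} (hr0 : 0 < r) (hr : r < 1) (φ : ℝ) :
    0 < 1 - r * Real.cos φ := by
  nlinarith [Real.cos_le_one φ]

lemma integrand_le_integrand {r r' φ : ℝ} (hcos : r * Real.cos φ ≤ r' * Real.cos φ)
    (hpos : 0 < 1 - r' * Real.cos φ) : 1 / (2 * orbit r φ) ≤ 1 / (2 * orbit r' φ) := by
  have h' := orbit_pos hpos
  have : orbit r' φ ≤ orbit r φ := Real.sqrt_le_sqrt (by linarith)
  gcongr

lemma strictMonoOn_lowerTime {c : ℝ} (hc : 0 < c) : StrictMonoOn (lowerTime c) (Ico c 1) := by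
  intro r hr r' hr' hlt
  have hr0 : 0 < r := hc.trans_le hr.1
  have hr0' : 0 < r' := hc.trans_le hr'.1
  set θ := Real.arccos (c / r) with hθ
  set θ' := Real.arccos (c / r') with hθ'
  have hθ0 : 0 ≤ θ := Real.arccos_nonneg _
  have hθθ' : θ < θ' := arccos_div_lt hc hr.1 hlt
  have hθπ : θ' ≤ π / 2 := arccos_div_le_pi_div_two hc hr'.1
  have hθπ' : θ' ≤ π := Real.arccos_le_pi _
  have hint : ∀ s, 0 < s → s < 1 → ∀ β ∈ Icc 0 π, ∀ γ ∈ Icc 0 π,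
      IntervalIntegrable (fun φ => 1 / (2 * orbit s φ)) volume β γ := fun s hs hs1 β hβ γ hγ =>
    intervalIntegrable_integrand hs le_rfl (one_sub_mul_cos_pos hs hs1 0) hβ hγ
  have m0 : (0 : ℝ) ∈ Icc 0 π := ⟨le_rfl, Real.pi_pos.le⟩
  have m1 : θ ∈ Icc 0 π := ⟨hθ0, by linarith⟩
  have m2 : θ' ∈ Icc 0 π := ⟨by linarith, hθπ'⟩
  have h1 : ∫ φ in 0..θ, 1 / (2 * orbit r φ) ≤ ∫ φ in 0..θ, 1 / (2 * orbit r' φ) := by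
    refine intervalIntegral.integral_mono_on hθ0 (hint r hr0 hr.2 _ m0 _ m1)
      (hint r' hr0' hr'.2 _ m0 _ m1) fun φ hφ => ?_
    refine integrand_le_integrand (mul_le_mul_of_nonneg_right hlt.le ?_)
      (one_sub_mul_cos_pos hr0' hr'.2 φ)
    exact Real.cos_nonneg_of_neg_pi_div_two_le_of_le (by linarith [hφ.1, Real.pi_pos])
      (by linarith [hφ.2])
  have h2 : 0 < ∫ φ in θ..θ', 1 / (2 * orbit r' φ) :=
    intervalIntegral.intervalIntegral_pos_of_pos_on (hint r' hr0' hr'.2 _ m1 _ m2)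
      (fun φ _ => by
        have := orbit_pos (one_sub_mul_cos_pos hr0' hr'.2 φ)
        positivity) hθθ'
  have h3 := intervalIntegral.integral_add_adjacent_intervals
    (hint r' hr0' hr'.2 _ m0 _ m1) (hint r' hr0' hr'.2 _ m1 _ m2)
  change ∫ φ in 0..θ, 1 / (2 * orbit r φ) < ∫ φ in 0..θ', 1 / (2 * orbit r' φ)
  linarith

lemma continuousOn_lowerTime {c : ℝ} (hc : 0 < c) : ContinuousOn (lowerTime c) (Ico c 1) := by
  rw [continuousOn_iff_continuous_domRestrict]
  refine intervalIntegral.continuous_parametric_intervalIntegral_of_continuous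
    (f := fun (r : Ico c 1) φ => 1 / (2 * orbit r φ)) ?_ ?_
  · have h : Continuous fun p : Ico c 1 × ℝ => orbit p.1 p.2 :=
      continuous_orbit.comp (by fun_prop : Continuous fun p : Ico c 1 × ℝ => ((p.1 : ℝ), p.2))
    refine continuous_const.div (continuous_const.mul h) fun p => ?_
    have := orbit_pos (one_sub_mul_cos_pos (hc.trans_le p.1.2.1) p.1.2.2 p.2)
    positivity
  · exact Real.continuous_arccos.comp (continuous_const.div continuous_subtype_val
      fun r => (hc.trans_le r.2.1).ne')

lemma upperTime_eq_max {c r : ℝ} (hc : 0 < c) (hr : c ≤ r) :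
    upperTime c r = -∫ φ in π..Real.arccos (c / r),
      1 / (2 * Real.sqrt (max (1 - r * Real.cos φ) (1 - c) / 2)) := by
  rw [← intervalIntegral.integral_symm]
  refine intervalIntegral.integral_congr fun φ hφ => ?_
  rw [uIcc_of_le (Real.arccos_le_pi _)] at hφ
  have h := mul_le_mul_of_nonneg_left (cos_le_cos_of_mem (Real.arccos_nonneg _) hφ)
    (hc.trans_le hr).le
  rw [mul_cos_arccos_div hc hr] at h
  simp only [orbit]
  rw [max_eq_left (by linarith)]

lemma continuousOn_upperTime {c : ℝ} (hc : 0 < c) (hc1 : c < 1) :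
    ContinuousOn (upperTime c) (Ici c) := by
  have key : ContinuousOn (fun r => -∫ φ in π..Real.arccos (c / r),
      1 / (2 * Real.sqrt (max (1 - r * Real.cos φ) (1 - c) / 2))) (Ici c) := by
    rw [continuousOn_iff_continuous_domRestrict]
    refine (intervalIntegral.continuous_parametric_intervalIntegral_of_continuous
      (f := fun (r : Ici c) φ =>
        1 / (2 * Real.sqrt (max (1 - r * Real.cos φ) (1 - c) / 2))) ?_ ?_).neg
    · refine continuous_const.div (by fun_prop) fun p => ?_
      have : 0 < max (1 - p.1 * Real.cos p.2) (1 - c) := lt_max_of_lt_right (by linarith)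
      positivity
    · exact Real.continuous_arccos.comp (continuous_const.div continuous_subtype_val
        fun r => (hc.trans_le r.2).ne')
  exact key.congr fun r hr => upperTime_eq_max hc hr

lemma upperTime_pos {c r : ℝ} (hc : 0 < c) (hc1 : c < 1) (hr : c ≤ r) : 0 < upperTime c r := by
  have hr0 : 0 < r := hc.trans_le hr
  have h0 : 0 ≤ Real.arccos (c / r) := Real.arccos_nonneg _
  have hp := one_sub_mul_cos_arccos_pos hc hc1 hr
  have hθπ : Real.arccos (c / r) < π := by
    linarith [arccos_div_le_pi_div_two hc hr, Real.pi_pos]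
  refine intervalIntegral.intervalIntegral_pos_of_pos_on
    (intervalIntegrable_integrand hr0 h0 hp ⟨le_rfl, hθπ.le⟩ ⟨hθπ.le, le_rfl⟩) (fun φ hφ => ?_) hθπ
  have := orbit_pos (one_sub_pos_of_mem hr0 h0 hp (Ioo_subset_Icc_self hφ))
  positivity

lemma orbit_arccos_div {c r : ℝ} (hc : 0 < c) (hr : c ≤ r) :
    orbit r (Real.arccos (c / r)) = Real.sqrt ((1 - c) / 2) := by
  rw [orbit, mul_cos_arccos_div hc hr]

/-- Splitting the upper time at the critical point of `A`, where `φ = π / 2`. -/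
lemma upperTime_eq_add {c r : ℝ} (hc : 0 < c) (hc1 : c < 1) (hr : c ≤ r) :
    upperTime c r = (∫ u in Real.sqrt ((1 - c) / 2)..Real.sqrt (1 / 2),
        1 / Real.sqrt ((r ^ 2 - 1) / 4 + A u)) +
      ∫ φ in (π / 2)..π, 1 / (2 * orbit r φ) := by
  have hr0 : 0 < r := hc.trans_le hr
  have h0 : 0 ≤ Real.arccos (c / r) := Real.arccos_nonneg _
  have hp := one_sub_mul_cos_arccos_pos hc hc1 hr
  have hθ := arccos_div_le_pi_div_two hc hr
  have hπ := Real.pi_pos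
  have ho : orbit r (π / 2) = Real.sqrt (1 / 2) := by simp [orbit]
  rw [← orbit_arccos_div hc hr, ← ho, integral_orbit hr0 h0 hθ (by linarith) hp,
    intervalIntegral.integral_add_adjacent_intervals]
  · rfl
  · exact intervalIntegrable_integrand hr0 h0 hp ⟨le_rfl, by linarith⟩ ⟨hθ, by linarith⟩
  · exact intervalIntegrable_integrand hr0 h0 hp ⟨hθ, by linarith⟩ ⟨by linarith, le_rfl⟩

lemma antitoneOn_upperTime {c : ℝ} (hc : 0 < c) (hc1 : c < 1) :
    AntitoneOn (upperTime c) (Ioi c) := by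
  intro r hr r' hr' hle
  have hr0 : 0 < r := hc.trans hr
  have hr0' : 0 < r' := hc.trans hr'
  rw [upperTime_eq_add hc hc1 (le_of_lt hr), upperTime_eq_add hc hc1 (le_of_lt hr')]
  have hle' : Real.sqrt ((1 - c) / 2) ≤ Real.sqrt (1 / 2) := Real.sqrt_le_sqrt (by linarith)
  have hE : ∀ s, c < s → ∀ u ∈ Icc (Real.sqrt ((1 - c) / 2)) (Real.sqrt (1 / 2)),
      0 < (s ^ 2 - 1) / 4 + A u := by
    intro s hs u hu
    have hu0 : 0 ≤ u := (Real.sqrt_nonneg _).trans hu.1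
    have h1 : (1 - c) / 2 ≤ u ^ 2 := by
      have := (Real.sqrt_le_left hu0).1 hu.1
      exact this
    have h2 : u ^ 2 ≤ 1 / 2 := (Real.le_sqrt hu0 (by norm_num)).1 hu.2
    unfold A
    nlinarith
  have hcont : ∀ s, c < s → IntervalIntegrable
      (fun u => 1 / Real.sqrt ((s ^ 2 - 1) / 4 + A u)) volume
      (Real.sqrt ((1 - c) / 2)) (Real.sqrt (1 / 2)) := by
    intro s hs
    refine ContinuousOn.intervalIntegrable ?_
    rw [uIcc_of_le hle']
    refine continuousOn_const.div (by unfold A; fun_prop) fun u hu => ?_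
    exact (Real.sqrt_pos.2 (hE s hs u hu)).ne'
  refine add_le_add ?_ ?_
  · refine intervalIntegral.integral_mono_on hle' (hcont _ hr') (hcont _ hr) fun u hu => ?_
    have := Real.sqrt_pos.2 (hE r hr u hu)
    gcongr
  · have hπ := Real.pi_pos
    have hint : ∀ s, 0 < s → IntervalIntegrable (fun φ => 1 / (2 * orbit s φ)) volume (π / 2) π :=
      fun s hs => intervalIntegrable_integrand (α := π / 2) hs (by linarith) (by simp)
        ⟨le_rfl, by linarith⟩ ⟨by linarith, le_rfl⟩
    refine intervalIntegral.integral_mono_on (by linarith) (hint _ hr0') (hint _ hr0)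
      fun φ hφ => ?_
    have hcos : Real.cos φ ≤ 0 :=
      Real.cos_nonpos_of_pi_div_two_le_of_le hφ.1 (by linarith [hφ.2])
    refine integrand_le_integrand (mul_le_mul_of_nonpos_right hle hcos) ?_
    nlinarith

/-- A logarithmic lower bound for the lower time near the separatrix `r = 1`. -/
lemma log_le_lowerTime {c r s δ : ℝ} (hr0 : 0 < r) (hr1 : r < 1)
    (hδ : 0 ≤ δ) (hδr : δ ≤ Real.arccos (c / r)) (hs : 0 < s) (hrs : 2 * (1 - r) ≤ s ^ 2) :
    Real.log ((s + δ) / s) ≤ lowerTime c r := by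
  have hpos := one_sub_mul_cos_pos hr0 hr1
  have hπ : Real.arccos (c / r) ≤ π := Real.arccos_le_pi _
  have hint : ∀ β ∈ Icc 0 π, ∀ γ ∈ Icc 0 π,
      IntervalIntegrable (fun φ => 1 / (2 * orbit r φ)) volume β γ := fun β hβ γ hγ =>
    intervalIntegrable_integrand hr0 le_rfl (hpos 0) hβ hγ
  have m0 : (0 : ℝ) ∈ Icc 0 π := ⟨le_rfl, Real.pi_pos.le⟩
  have m1 : δ ∈ Icc 0 π := ⟨hδ, by linarith⟩
  have m2 : Real.arccos (c / r) ∈ Icc 0 π := ⟨by linarith, hπ⟩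
  have h1 : 0 ≤ ∫ φ in δ..Real.arccos (c / r), 1 / (2 * orbit r φ) :=
    intervalIntegral.integral_nonneg hδr fun φ _ => by
      have := orbit_pos (hpos φ)
      positivity
  have h2 : ∫ φ in 0..δ, 1 / (s + φ) ≤ ∫ φ in 0..δ, 1 / (2 * orbit r φ) := by
    refine intervalIntegral.integral_mono_on hδ ?_ (hint _ m0 _ m1) fun φ hφ => ?_
    · refine ContinuousOn.intervalIntegrable ?_
      rw [uIcc_of_le hδ]
      exact continuousOn_const.div (by fun_prop) fun φ hφ => by linarith [hφ.1]
    · have ho := orbit_pos (hpos φ)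
      have ho2 : orbit r φ ^ 2 = (1 - r * Real.cos φ) / 2 := Real.sq_sqrt (by linarith [hpos φ])
      have hcos := Real.one_sub_sq_div_two_le_cos (x := φ)
      have h3 : r * (1 - φ ^ 2 / 2) ≤ r * Real.cos φ := by gcongr
      have h4 : (2 * orbit r φ) ^ 2 ≤ (s + φ) ^ 2 := by
        nlinarith [hφ.1, mul_nonneg hs.le hφ.1, mul_nonneg (sub_nonneg.2 hr1.le) (sq_nonneg φ)]
      have h5 : 2 * orbit r φ ≤ s + φ := le_of_sq_le_sq h4 (by linarith [hφ.1])
      gcongr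
  have h3 : ∫ φ in 0..δ, 1 / (s + φ) = Real.log ((s + δ) / s) := by
    rw [intervalIntegral.integral_comp_add_left (fun x => 1 / x), add_zero,
      integral_one_div_of_pos hs (by linarith)]
  rw [lowerTime, ← intervalIntegral.integral_add_adjacent_intervals (hint _ m0 _ m1)
    (hint _ m1 _ m2)]
  linarith

lemma exists_lt_lowerTime {c : ℝ} (hc : 0 < c) (hc1 : c < 1) (M : ℝ) :
    ∃ r ∈ Ioo c 1, M < lowerTime c r := by
  set r₀ := (c + 1) / 2 with hr₀
  have hcr₀ : c < r₀ := by linarith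
  have hr₀0 : 0 < r₀ := by linarith
  set δ := Real.arccos (c / r₀) with hδ
  have hδ0 : 0 < δ := Real.arccos_pos.2 ((div_lt_one hr₀0).2 hcr₀)
  set s := δ * Real.exp (-M) with hs
  have hs0 : 0 < s := by positivity
  set r := max r₀ (1 - s ^ 2 / 2) with hr
  have hr₀r : r₀ ≤ r := le_max_left _ _
  have hrs : 1 - s ^ 2 / 2 ≤ r := le_max_right _ _
  have hr1 : r < 1 := max_lt (by linarith) (by nlinarith)
  refine ⟨r, ⟨by linarith, hr1⟩, lt_of_lt_of_le ?_ (log_le_lowerTime (by linarith) hr1 hδ0.le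
    (Real.arccos_le_arccos (div_le_div_of_nonneg_left hc.le hr₀0 hr₀r)) hs0 (by linarith))⟩
  rw [Real.lt_log_iff_exp_lt (by positivity), lt_div_iff₀ hs0, hs, mul_left_comm, ← Real.exp_add]
  simp only [add_neg_cancel, Real.exp_zero, mul_one]
  linarith

/-- The radius `√(1 + 4E)` of the orbit through `(p₀, q)`, where `c = 1 - 2 p₀²`. -/
noncomputable def radius (c q : ℝ) : ℝ := Real.sqrt (c ^ 2 + 4 * q ^ 2)

lemma radius_sq (c q : ℝ) : radius c q ^ 2 = c ^ 2 + 4 * q ^ 2 := Real.sq_sqrt (by positivity)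

lemma radius_zero {c : ℝ} (hc : 0 ≤ c) : radius c 0 = c := by simp [radius, Real.sqrt_sq hc]

lemma radius_lt_radius {c q q' : ℝ} (hq : 0 ≤ q) (h : q < q') : radius c q < radius c q' :=
  Real.sqrt_lt_sqrt (by positivity) (by gcongr)

lemma lt_radius {c q : ℝ} (hc : 0 ≤ c) (hq : 0 < q) : c < radius c q := by
  simpa [radius_zero hc] using radius_lt_radius (c := c) le_rfl hq

lemma le_radius (c q : ℝ) : c ≤ radius c q :=
  Real.le_sqrt_of_sq_le (by nlinarith [sq_nonneg q])

lemma continuous_radius (c : ℝ) : Continuous (radius c) := by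
  unfold radius
  fun_prop

section Period

variable {p₀ q : ℝ}

lemma energy_eq (p₀ q : ℝ) :
    q ^ 2 - A p₀ = (radius (1 - 2 * p₀ ^ 2) q ^ 2 - 1) / 4 := by
  rw [radius_sq, A]
  ring

lemma sqrt_one_add_four_energy (p₀ q : ℝ) :
    Real.sqrt (1 + 4 * (q ^ 2 - A p₀)) = radius (1 - 2 * p₀ ^ 2) q := by
  rw [radius, A]
  ring_nf

lemma eq_orbit_arccos (hp : 0 ≤ p₀) (hc : 0 < 1 - 2 * p₀ ^ 2) :
    p₀ = orbit (radius (1 - 2 * p₀ ^ 2) q)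
      (Real.arccos ((1 - 2 * p₀ ^ 2) / radius (1 - 2 * p₀ ^ 2) q)) := by
  rw [orbit_arccos_div hc (le_radius _ _), show (1 - (1 - 2 * p₀ ^ 2)) / 2 = p₀ ^ 2 by ring,
    Real.sqrt_sq hp]

lemma Tplus_eq_upperTime (hp : 0 < p₀) (hc : 0 < 1 - 2 * p₀ ^ 2) :
    Tplus p₀ q = upperTime (1 - 2 * p₀ ^ 2) (radius (1 - 2 * p₀ ^ 2) q) := by
  have hr := le_radius (1 - 2 * p₀ ^ 2) q
  have htop : pPlus (q ^ 2 - A p₀) = orbit (radius (1 - 2 * p₀ ^ 2) q) π := by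
    rw [pPlus, sqrt_one_add_four_energy, orbit, Real.cos_pi]
    ring_nf
  rw [Tplus, htop, energy_eq, upperTime, ← integral_orbit (hc.trans_le hr) (Real.arccos_nonneg _)
    (Real.arccos_le_pi _) le_rfl (one_sub_mul_cos_arccos_pos hc (by nlinarith) hr),
    ← eq_orbit_arccos hp.le hc]

lemma Tminus_eq_lowerTime (hp : 0 < p₀) (hc : 0 < 1 - 2 * p₀ ^ 2)
    (hq : radius (1 - 2 * p₀ ^ 2) q < 1) :
    Tminus p₀ q = lowerTime (1 - 2 * p₀ ^ 2) (radius (1 - 2 * p₀ ^ 2) q) := by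
  have hr := hc.trans_le (le_radius _ q)
  have hbot : pMinus (q ^ 2 - A p₀) = orbit (radius (1 - 2 * p₀ ^ 2) q) 0 := by
    rw [pMinus, sqrt_one_add_four_energy, orbit, Real.cos_zero, mul_one]
  rw [Tminus, hbot, energy_eq, lowerTime, ← integral_orbit hr le_rfl (Real.arccos_nonneg _)
    (Real.arccos_le_pi _) (one_sub_mul_cos_pos hr hq 0), ← eq_orbit_arccos hp.le hc]

end Period

/-- Along an increasing affine relation `q ↦ b + m q` with `b > 0`, `m ≥ 0`, the lower and upper
times agree exactly once. -/
lemma existsUnique_lowerTime_eq_upperTime {c a b m : ℝ} (hc : 0 < c) (hc1 : c < 1) (ha : 0 ≤ a)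
    (hca : c ^ 2 + 4 * a ^ 2 = 1) (hb : 0 < b) (hm : 0 ≤ m) :
    ∃! q, q ∈ Ioo 0 a ∧ upperTime c (radius c (b + m * q)) = lowerTime c (radius c q) := by
  have hra : radius c a = 1 := by rw [radius, hca, Real.sqrt_one]
  have hmem : ∀ q ∈ Ico 0 a, radius c q ∈ Ico c 1 := fun q hq =>
    ⟨le_radius _ _, hra ▸ radius_lt_radius hq.1 hq.2⟩
  have hanti : ∀ q q', 0 ≤ q → q ≤ q' →
      upperTime c (radius c (b + m * q')) ≤ upperTime c (radius c (b + m * q)) := by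
    intro q q' hq hqq'
    have h0 : 0 < b + m * q := by positivity
    have hle : b + m * q ≤ b + m * q' := by gcongr
    refine antitoneOn_upperTime hc hc1 (lt_radius hc.le h0)
      (lt_radius hc.le (h0.trans_le hle)) ?_
    rcases hle.eq_or_lt with h | h
    · rw [h]
    · exact (radius_lt_radius h0.le h).le
  have hmono : ∀ q q', 0 < q → q < q' → q' < a →
      lowerTime c (radius c q) < lowerTime c (radius c q') := fun q q' hq hqq' hq' =>
    strictMonoOn_lowerTime hc (hmem q ⟨hq.le, hqq'.trans hq'⟩) (hmem q' ⟨(hq.trans hqq').le, hq'⟩)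
      (radius_lt_radius hq.le hqq')
  obtain ⟨r, hr, hM⟩ := exists_lt_lowerTime hc hc1 (upperTime c (radius c (b + m * 0)))
  set Q := Real.sqrt (r ^ 2 - c ^ 2) / 2 with hQ
  have hQ2 : 4 * Q ^ 2 = r ^ 2 - c ^ 2 := by
    rw [hQ, div_pow, Real.sq_sqrt (by nlinarith [hr.1])]
    ring
  have hQ0 : 0 ≤ Q := by positivity
  have hQa : Q < a := lt_of_pow_lt_pow_left₀ 2 ha (by nlinarith [hr.1, hr.2])
  have hrQ : radius c Q = r := by
    rw [radius, hQ2, add_sub_cancel, Real.sqrt_sq (hc.trans hr.1).le]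
  have hcont : ContinuousOn
      (fun q => lowerTime c (radius c q) - upperTime c (radius c (b + m * q))) (Icc 0 Q) := by
    refine ContinuousOn.sub ?_ ?_
    · exact (continuousOn_lowerTime hc).comp (continuous_radius c).continuousOn
        fun q hq => hmem q ⟨hq.1, hq.2.trans_lt hQa⟩
    · exact (continuousOn_upperTime hc hc1).comp
        ((continuous_radius c).comp (by fun_prop : Continuous fun q => b + m * q)).continuousOn
        fun q _ => le_radius _ _
  have hzero : lowerTime c (radius c 0) - upperTime c (radius c (b + m * 0)) < 0 := by
    have h0 : lowerTime c (radius c 0) = 0 := by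
      simp [radius_zero hc.le, lowerTime, div_self hc.ne']
    rw [h0]
    linarith [upperTime_pos hc hc1 (le_radius _ (b + m * 0))]
  have htop : 0 < lowerTime c (radius c Q) - upperTime c (radius c (b + m * Q)) := by
    rw [hrQ]
    linarith [hanti 0 Q le_rfl hQ0]
  obtain ⟨q, hq, hq0⟩ := intermediate_value_Icc hQ0 hcont ⟨hzero.le, htop.le⟩
  simp only at hq0
  have hqpos : 0 < q := by
    refine lt_of_le_of_ne hq.1 fun h => ?_
    rw [← h] at hq0
    exact hzero.ne hq0
  refine ⟨q, ⟨⟨hqpos, hq.2.trans_lt hQa⟩, by linarith⟩, ?_⟩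
  rintro q' ⟨⟨hq'0, hq'a⟩, hq'⟩
  rcases lt_trichotomy q' q with h | h | h
  · have := hmono q' q hq'0 h (hq.2.trans_lt hQa)
    have := hanti q' q hq'0.le h.le
    linarith
  · exact h
  · have := hmono q q' hqpos h hq'a
    have := hanti q q' hqpos.le h.le
    linarith

/-- fix `N ≥ 2` and `1 ≤ K ≤ N−1`. For every `p₀ ∈ (0, p⋆)` there is exactly
one pair `(q₁, q_N)` with `q₁ > 0`, `q_N ∈ (0, √A(p₀))`, `T₊(p₀,q₁) = T₋(p₀,q_N)` and
`2Kq₁ − 2(N−K)q_N = √A(p₀)`; moreover `q₁ ∈ [(1/(2K))√A(p₀), ((2(N−K)+1)/(2K))√A(p₀)]`. -/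
theorem Ksplit_existence_uniqueness (N K : ℕ) (hN : 2 ≤ N) (hK1 : 1 ≤ K) (hKN : K ≤ N - 1) :
    ∀ p₀ ∈ Set.Ioo 0 pstar,
      (∃! q : ℝ × ℝ,
        0 < q.1 ∧ q.2 ∈ Set.Ioo 0 (Real.sqrt (A p₀)) ∧
        Tplus p₀ q.1 = Tminus p₀ q.2 ∧
        2 * (K : ℝ) * q.1 - 2 * ((N : ℝ) - (K : ℝ)) * q.2 = Real.sqrt (A p₀)) ∧
      (∀ q : ℝ × ℝ,
        0 < q.1 → q.2 ∈ Set.Ioo 0 (Real.sqrt (A p₀)) →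
        Tplus p₀ q.1 = Tminus p₀ q.2 →
        2 * (K : ℝ) * q.1 - 2 * ((N : ℝ) - (K : ℝ)) * q.2 = Real.sqrt (A p₀) →
        q.1 ∈ Set.Icc (1 / (2 * (K : ℝ)) * Real.sqrt (A p₀))
          ((2 * ((N : ℝ) - (K : ℝ)) + 1) / (2 * (K : ℝ)) * Real.sqrt (A p₀))) := by
  have hK : (1 : ℝ) ≤ K := by exact_mod_cast hK1
  have hNK : (0 : ℝ) ≤ (N : ℝ) - K := by
    rw [sub_nonneg]
    exact_mod_cast hKN.trans (Nat.sub_le N 1)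
  rintro p₀ ⟨hp0, hp⟩
  have hp2 : p₀ ^ 2 < 1 / 2 := by
    have h := pow_lt_pow_left₀ hp hp0.le two_ne_zero
    rwa [pstar, div_pow, Real.sq_sqrt (by norm_num), one_pow] at h
  have hc : 0 < 1 - 2 * p₀ ^ 2 := by linarith
  have hc1 : 1 - 2 * p₀ ^ 2 < 1 := by nlinarith
  have hA : 0 < A p₀ := mul_pos (by positivity) (by linarith)
  set a := Real.sqrt (A p₀) with ha
  have ha0 : 0 < a := Real.sqrt_pos.2 hA
  have hca : (1 - 2 * p₀ ^ 2) ^ 2 + 4 * a ^ 2 = 1 := by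
    rw [ha, Real.sq_sqrt hA.le, A]
    ring
  have hlin : ∀ x y : ℝ, 2 * (K : ℝ) * x - 2 * ((N : ℝ) - K) * y = a ↔
      x = a / (2 * K) + ((N : ℝ) - K) / K * y := by
    intro x y
    field_simp
    constructor <;> intro h <;> linarith
  refine ⟨?_, ?_⟩
  · have hlow : ∀ q ∈ Ioo 0 a, Tminus p₀ q =
        lowerTime (1 - 2 * p₀ ^ 2) (radius (1 - 2 * p₀ ^ 2) q) := fun q hq => by
      refine Tminus_eq_lowerTime hp0 hc ?_
      have h := radius_lt_radius (c := 1 - 2 * p₀ ^ 2) hq.1.le hq.2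
      rwa [radius.eq_1 _ a, hca, Real.sqrt_one] at h
    obtain ⟨y, ⟨hy, hy'⟩, huniq⟩ := existsUnique_lowerTime_eq_upperTime hc hc1 ha0.le hca
      (b := a / (2 * K)) (m := ((N : ℝ) - K) / K) (by positivity) (by positivity)
    refine ⟨(a / (2 * K) + ((N : ℝ) - K) / K * y, y), ⟨?_, hy, ?_, (hlin _ _).2 rfl⟩, ?_⟩
    · have := hy.1
      positivity
    · rw [Tplus_eq_upperTime hp0 hc, hlow y hy, hy']
    · rintro ⟨x', y'⟩ ⟨-, hy1, hT, hL⟩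
      have hx := (hlin _ _).1 hL
      simp only at hx hT hy1
      rw [Tplus_eq_upperTime hp0 hc, hlow y' hy1, hx] at hT
      have hyy := huniq y' ⟨hy1, hT⟩
      rw [hx, hyy]
  · rintro ⟨x, y⟩ - hy - hL
    have hx := (hlin _ _).1 hL
    simp only at hx hy ⊢
    have h1 : 0 ≤ ((N : ℝ) - K) / K * y := mul_nonneg (by positivity) hy.1.le
    have h2 : ((N : ℝ) - K) / K * y ≤ ((N : ℝ) - K) / K * a :=
      mul_le_mul_of_nonneg_left hy.2.le (by positivity)
    have e1 : 1 / (2 * (K : ℝ)) * a = a / (2 * K) := by ring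
    have e2 : (2 * ((N : ℝ) - K) + 1) / (2 * (K : ℝ)) * a =
        a / (2 * K) + ((N : ℝ) - K) / K * a := by
      field_simp
      ring
    rw [mem_Icc, e1, e2, hx]
    exact ⟨by linarith, by linarith⟩
end
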